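/- There exist constants ε₀ > 0 and C > 0 depending only on k such that the following holds (small set expansion). Let 0 < ε ≤ ε₀, let μ be an ε-product probability measure on V = V₁×⋯×V_k, let ρ ∈ (0,1), let d ≤ k, let δ > 0, and let f : V → {0,1} be (d,δ)-global. Then ‖T_ρ f‖₂² ≤ (ρ^d + (200d)^d·δ^{1/2} + C·√ε)·‖f‖₂². -/

import Mathlib

open Finset

namespace GLL

variable {k : ℕ} {V : Fin k → Type} [∀ i, Fintype (V i)] [∀ i, DecidableEq (V i)]

/-- Expectation of `f` with respect to the (finitely supported) measure `μ`. -/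
def expect (μ f : (∀ i, V i) → ℝ) : ℝ := ∑ x, μ x * f x

/-- `μ` is a probability measure. -/
def IsProb (μ : (∀ i, V i) → ℝ) : Prop := (∀ x, 0 ≤ μ x) ∧ ∑ x, μ x = 1

/-- The marginal `μ_S` evaluated at (the `S`-coordinates of) `x`. -/
def marg (μ : (∀ i, V i) → ℝ) (S : Finset (Fin k)) (x : ∀ i, V i) : ℝ :=
  ∑ z, if ∀ i ∈ S, z i = x i then μ z else 0

/-- The link (conditional) measure `μ_x` for `x ∈ V_S`, viewed as a measure on
full points agreeing with `x` on `S`. -/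
noncomputable def cond (μ : (∀ i, V i) → ℝ) (S : Finset (Fin k)) (x z : ∀ i, V i) : ℝ :=
  if ∀ i ∈ S, z i = x i then μ z / marg μ S x else 0

/-- The averaging operator `A_S`: `A_S f (x) = E_{y ∼ μ_{x_S}} [f(x_S, y)]`.
Applied to an `S'`-junta `f`, this is also the operator `A_{S',S}`. -/
noncomputable def Aop (μ : (∀ i, V i) → ℝ) (S : Finset (Fin k)) (f : (∀ i, V i) → ℝ)
    (x : ∀ i, V i) : ℝ :=
  ∑ z, cond μ S x z * f z

/-- The Efron–Stein component `f^{=S} = ∑_{T ⊆ S} (-1)^{|S∖T|} A_T f`. -/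
noncomputable def ES (μ : (∀ i, V i) → ℝ) (S : Finset (Fin k)) (f : (∀ i, V i) → ℝ)
    (x : ∀ i, V i) : ℝ :=
  ∑ T ∈ S.powerset, (-1 : ℝ) ^ (S.card - T.card) * Aop μ T f x

/-- The low-degree part `f^{≤ d} = ∑_{|S| ≤ d} f^{=S}`. -/
noncomputable def lowPart (μ : (∀ i, V i) → ℝ) (d : ℕ) (f : (∀ i, V i) → ℝ)
    (x : ∀ i, V i) : ℝ :=
  ∑ S ∈ univ.powerset.filter (fun S : Finset (Fin k) => S.card ≤ d), ES μ S f x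

/-- The Laplacian `L_S[f] = ∑_{T ⊇ S} f^{=T}`. -/
noncomputable def Lap (μ : (∀ i, V i) → ℝ) (S : Finset (Fin k)) (f : (∀ i, V i) → ℝ)
    (x : ∀ i, V i) : ℝ :=
  ∑ T ∈ univ.powerset.filter (fun T : Finset (Fin k) => S ⊆ T), ES μ T f x

/-- The truncated Laplacian `L_S^{≤d}[f] = ∑_{T ⊇ S, |T| ≤ d} f^{=T}`. -/
noncomputable def LapLe (μ : (∀ i, V i) → ℝ) (d : ℕ) (S : Finset (Fin k))
    (f : (∀ i, V i) → ℝ) (x : ∀ i, V i) : ℝ :=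
  ∑ T ∈ univ.powerset.filter (fun T : Finset (Fin k) => S ⊆ T ∧ T.card ≤ d), ES μ T f x

/-- The influence `I_{S,x}[f] = ‖L_S[f](x,·)‖²_{L²(μ_x)}`. -/
noncomputable def Inf (μ : (∀ i, V i) → ℝ) (S : Finset (Fin k)) (f : (∀ i, V i) → ℝ)
    (x : ∀ i, V i) : ℝ :=
  ∑ z, cond μ S x z * (Lap μ S f z) ^ 2

/-- The truncated influence `I^{≤d}_{S,x}[f] = ‖L_S^{≤d}[f](x,·)‖²_{L²(μ_x)}`. -/
noncomputable def InfLe (μ : (∀ i, V i) → ℝ) (d : ℕ) (S : Finset (Fin k))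
    (f : (∀ i, V i) → ℝ) (x : ∀ i, V i) : ℝ :=
  ∑ z, cond μ S x z * (LapLe μ d S f z) ^ 2

/-- `‖f‖₂²` with respect to `μ`. -/
def normSq (μ f : (∀ i, V i) → ℝ) : ℝ := ∑ x, μ x * (f x) ^ 2

/-- `‖f‖₄⁴` with respect to `μ`. -/
def norm4p4 (μ f : (∀ i, V i) → ℝ) : ℝ := ∑ x, μ x * (f x) ^ 4

/-- `‖f‖₂` with respect to `μ`. -/
noncomputable def l2norm (μ f : (∀ i, V i) → ℝ) : ℝ := Real.sqrt (normSq μ f)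

/-- `‖f‖_∞`: the maximum of `|f|` over the support of `μ`. -/
noncomputable def supNorm (μ f : (∀ i, V i) → ℝ) : ℝ :=
  sSup ((fun x => |f x|) '' {x | 0 < μ x})

/-- Inner product `⟨f, g⟩ = E_{x∼μ}[f(x) g(x)]`. -/
def inner' (μ f g : (∀ i, V i) → ℝ) : ℝ := ∑ x, μ x * (f x * g x)

/-- The pair `{i,j}`-skeleton of `μ` is `ε`-pseudorandom. -/
def PairPseudo (μ : (∀ i, V i) → ℝ) (ε : ℝ) (i j : Fin k) : Prop :=
  ∀ (f₁ : V i → ℝ) (f₂ : V j → ℝ),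
    |expect μ (fun x => f₁ (x i) * f₂ (x j)) -
        expect μ (fun x => f₁ (x i)) * expect μ (fun x => f₂ (x j))| ≤
      ε * Real.sqrt
        ((expect μ (fun x => f₁ (x i) ^ 2) - expect μ (fun x => f₁ (x i)) ^ 2) *
          (expect μ (fun x => f₂ (x j) ^ 2) - expect μ (fun x => f₂ (x j)) ^ 2))

/-- `μ` is an `ε`-product measure: every link of every restriction of size `≤ k - 2`
has `ε`-pseudorandom skeletons. -/
def EpsProduct (μ : (∀ i, V i) → ℝ) (ε : ℝ) : Prop :=
  ∀ S : Finset (Fin k), S.card ≤ k - 2 → ∀ x, 0 < marg μ S x →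
    ∀ i j : Fin k, i ∉ S → j ∉ S → i ≠ j → PairPseudo (cond μ S x) ε i j

/-- `‖f(x,·)‖_{L²(μ_x)}` for `x ∈ V_S`. -/
noncomputable def restrictNorm (μ : (∀ i, V i) → ℝ) (S : Finset (Fin k)) (x : ∀ i, V i)
    (f : (∀ i, V i) → ℝ) : ℝ :=
  Real.sqrt (∑ z, cond μ S x z * (f z) ^ 2)

/-- `f` is `(d, δ)`-global: all restrictions of at most `d` coordinates have
`2`-norm at most `δ`. -/
def IsGlobal (μ : (∀ i, V i) → ℝ) (d : ℕ) (δ : ℝ) (f : (∀ i, V i) → ℝ) : Prop :=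
  ∀ S : Finset (Fin k), S.card ≤ d → ∀ x, 0 < marg μ S x → restrictNorm μ S x f ≤ δ

/-- `f` is an `S`-junta: it depends only on the coordinates in `S`. -/
def Junta (S : Finset (Fin k)) (f : (∀ i, V i) → ℝ) : Prop :=
  ∀ x y, (∀ i ∈ S, x i = y i) → f x = f y

/-- The noise operator `T_ρ f = ∑_{S ⊆ [k]} ρ^{|S|} (1-ρ)^{k-|S|} A_S f`. -/
noncomputable def noiseOp (μ : (∀ i, V i) → ℝ) (ρ : ℝ) (f : (∀ i, V i) → ℝ)
    (x : ∀ i, V i) : ℝ :=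
  ∑ S ∈ (univ : Finset (Fin k)).powerset, ρ ^ S.card * (1 - ρ) ^ (k - S.card) * Aop μ S f x

/-- The up-down walk operator `T = (1/k) ∑_{i=1}^k A_{[k]∖{i}}`. -/
noncomputable def upDown (μ : (∀ i, V i) → ℝ) (f : (∀ i, V i) → ℝ) (x : ∀ i, V i) : ℝ :=
  (1 / (k : ℝ)) * ∑ i : Fin k, Aop μ (univ.erase i) f x

/-- The product measure `μ₁ ⊗ ⋯ ⊗ μ_k`. -/
def prodMeasure (μi : ∀ i, V i → ℝ) : (∀ i, V i) → ℝ := fun x => ∏ i, μi i (x i)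

/-- `f` has degree at most `d`: `f^{=S} = 0` whenever `|S| > d`. -/
def DegLe (μ : (∀ i, V i) → ℝ) (d : ℕ) (f : (∀ i, V i) → ℝ) : Prop :=
  ∀ S : Finset (Fin k), d < S.card → ∀ x, ES μ S f x = 0

/-- `{F S}_{S ⊆ [k]}` is an `(α, ε')`-approximate Efron–Stein decomposition of `f`. -/
noncomputable def ApproxES (μ : (∀ i, V i) → ℝ) (α ε' : ℝ) (f : (∀ i, V i) → ℝ)
    (F : Finset (Fin k) → (∀ i, V i) → ℝ) : Prop :=
  l2norm μ f ≤ α ∧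
    l2norm μ (fun x => f x - ∑ S ∈ (univ : Finset (Fin k)).powerset, F S x) ≤ ε' ∧
    ∀ S : Finset (Fin k), ∃ h : (∀ i, V i) → ℝ,
      l2norm μ h ≤ α ∧ l2norm μ (fun x => ES μ S h x - F S x) ≤ ε'

set_option linter.unusedSectionVars false

/-! ### Expectations and norms -/

section Expectation

variable {μ : (∀ i, V i) → ℝ} {f g h : (∀ i, V i) → ℝ}

lemma expect_add : expect μ (f + g) = expect μ f + expect μ g := by
  simp [expect, mul_add, sum_add_distrib]

lemma expect_sub : expect μ (f - g) = expect μ f - expect μ g := by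
  simp [expect, mul_sub, sum_sub_distrib]

lemma expect_smul (c : ℝ) : expect μ (c • f) = c * expect μ f := by
  simp only [expect, mul_sum, Pi.smul_apply, smul_eq_mul]
  exact sum_congr rfl fun x _ => by ring

lemma expect_sum {ι : Type*} (s : Finset ι) (F : ι → (∀ i, V i) → ℝ) :
    expect μ (∑ i ∈ s, F i) = ∑ i ∈ s, expect μ (F i) := by
  simp only [expect, Finset.sum_apply, mul_sum]
  exact sum_comm

lemma expect_congr (H : ∀ x, μ x ≠ 0 → f x = g x) : expect μ f = expect μ g := by
  refine sum_congr rfl fun x _ => ?_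
  by_cases hx : μ x = 0
  · simp [hx]
  · rw [H x hx]

lemma expect_mono (hμ : IsProb μ) (H : ∀ x, 0 < μ x → f x ≤ g x) :
    expect μ f ≤ expect μ g := by
  refine sum_le_sum fun x _ => ?_
  rcases (hμ.1 x).eq_or_lt with hx | hx
  · simp [← hx]
  · exact mul_le_mul_of_nonneg_left (H x hx) hx.le

lemma expect_nonneg (hμ : IsProb μ) (H : ∀ x, 0 ≤ f x) : 0 ≤ expect μ f :=
  sum_nonneg fun x _ => mul_nonneg (hμ.1 x) (H x)

lemma normSq_eq : normSq μ f = expect μ (f ^ 2) := rfl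

lemma normSq_nonneg (hμ : IsProb μ) (f : (∀ i, V i) → ℝ) : 0 ≤ normSq μ f :=
  expect_nonneg hμ fun x => sq_nonneg (f x)

lemma l2norm_nonneg : 0 ≤ l2norm μ f := Real.sqrt_nonneg _

lemma l2norm_sq (hμ : IsProb μ) (f : (∀ i, V i) → ℝ) :
    l2norm μ f ^ 2 = expect μ (f ^ 2) :=
  Real.sq_sqrt (normSq_nonneg hμ f)

lemma l2norm_le (hμ : IsProb μ) {a : ℝ} (ha : 0 ≤ a) (H : expect μ (f ^ 2) ≤ a ^ 2) :
    l2norm μ f ≤ a :=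
  abs_le_of_sq_le_sq' (by rw [l2norm_sq hμ]; exact H) ha |>.2

lemma expect_mul_sq_le (hμ : IsProb μ) (f g : (∀ i, V i) → ℝ) :
    expect μ (f * g) ^ 2 ≤ expect μ (f ^ 2) * expect μ (g ^ 2) := by
  refine sum_sq_le_sum_mul_sum_of_sq_le_mul _ ?_ ?_ ?_
  · exact fun x _ => mul_nonneg (hμ.1 x) (sq_nonneg (f x))
  · exact fun x _ => mul_nonneg (hμ.1 x) (sq_nonneg (g x))
  · intro x _
    simp only [Pi.mul_apply, Pi.pow_apply]
    exact le_of_eq (by ring)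

lemma abs_expect_mul_le (hμ : IsProb μ) (f g : (∀ i, V i) → ℝ) :
    |expect μ (f * g)| ≤ l2norm μ f * l2norm μ g := by
  refine abs_le_of_sq_le_sq ?_ (mul_nonneg l2norm_nonneg l2norm_nonneg)
  rw [mul_pow, l2norm_sq hμ, l2norm_sq hμ]
  exact expect_mul_sq_le hμ f g

lemma l2norm_congr (H : ∀ x, μ x ≠ 0 → f x = g x) : l2norm μ f = l2norm μ g := by
  simp only [l2norm, normSq_eq]
  rw [expect_congr (μ := μ) (f := f ^ 2) (g := g ^ 2)]
  intro x hx
  simp [H x hx]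

lemma l2norm_mono (hμ : IsProb μ) (H : ∀ x, |f x| ≤ |g x|) : l2norm μ f ≤ l2norm μ g :=
  Real.sqrt_le_sqrt (expect_mono hμ fun x _ => sq_le_sq.2 (H x))

lemma l2norm_add_le (hμ : IsProb μ) (f g : (∀ i, V i) → ℝ) :
    l2norm μ (f + g) ≤ l2norm μ f + l2norm μ g := by
  refine l2norm_le hμ (add_nonneg l2norm_nonneg l2norm_nonneg) ?_
  have h1 : (f + g) ^ 2 = f ^ 2 + (2 : ℝ) • (f * g) + g ^ 2 := by
    ext x
    simp only [Pi.add_apply, Pi.mul_apply, Pi.pow_apply, Pi.smul_apply, smul_eq_mul]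
    ring
  rw [h1, expect_add, expect_add, expect_smul, ← l2norm_sq hμ, ← l2norm_sq hμ]
  have := le_of_abs_le (abs_expect_mul_le hμ f g)
  nlinarith

lemma l2norm_smul (c : ℝ) : l2norm μ (c • f) = |c| * l2norm μ f := by
  have h1 : (c • f) ^ 2 = (c ^ 2) • (f ^ 2) := by
    ext x
    simp only [Pi.pow_apply, Pi.smul_apply, smul_eq_mul]
    ring
  rw [l2norm, l2norm, normSq_eq, normSq_eq, h1, expect_smul, Real.sqrt_mul (sq_nonneg c),
    Real.sqrt_sq_eq_abs]

lemma l2norm_sum_le (hμ : IsProb μ) {ι : Type*} (s : Finset ι) (F : ι → (∀ i, V i) → ℝ) :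
    l2norm μ (∑ i ∈ s, F i) ≤ ∑ i ∈ s, l2norm μ (F i) := by
  classical
  induction s using Finset.induction_on with
  | empty => simp [l2norm, normSq]
  | insert a s ha ih =>
    rw [sum_insert ha, sum_insert ha]
    exact (l2norm_add_le hμ _ _).trans (by linarith)

lemma l2norm_sum_le_card (hμ : IsProb μ) {ι : Type*} (s : Finset ι)
    (F : ι → (∀ i, V i) → ℝ) {a : ℝ} (H : ∀ i ∈ s, l2norm μ (F i) ≤ a) :
    l2norm μ (∑ i ∈ s, F i) ≤ s.card * a :=
  (l2norm_sum_le hμ s F).trans ((sum_le_card_nsmul _ _ _ H).trans_eq (nsmul_eq_mul _ _))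

lemma l2norm_mul_le (hμ : IsProb μ) {B : ℝ} (H : ∀ x, |f x| ≤ B) :
    l2norm μ (f * g) ≤ B * l2norm μ g := by
  by_cases hne : Nonempty (∀ i, V i)
  · obtain ⟨x₀⟩ := hne
    have hB : 0 ≤ B := (abs_nonneg _).trans (H x₀)
    rw [← abs_of_nonneg hB, ← l2norm_smul]
    refine l2norm_mono hμ fun x => ?_
    simp only [Pi.mul_apply, Pi.smul_apply, smul_eq_mul, abs_mul, abs_of_nonneg hB]
    exact mul_le_mul_of_nonneg_right (H x) (abs_nonneg _)
  · rw [not_nonempty_iff] at hne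
    simp [l2norm, normSq]

end Expectation

/-! ### Juntas -/

section Junta

variable {S T : Finset (Fin k)} {f g : (∀ i, V i) → ℝ}

lemma Junta.mono (hf : Junta S f) (hST : S ⊆ T) : Junta T f :=
  fun x y hxy => hf x y fun i hi => hxy i (hST hi)

lemma Junta.mul (hf : Junta S f) (hg : Junta S g) : Junta S (f * g) :=
  fun x y hxy => by simp [hf x y hxy, hg x y hxy]

lemma Junta.pow (hf : Junta S f) (n : ℕ) : Junta S (f ^ n) :=
  fun x y hxy => by simp [hf x y hxy]

lemma Junta.comp (hf : Junta S f) (φ : ℝ → ℝ) : Junta S (fun x => φ (f x)) :=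
  fun x y hxy => by simp [hf x y hxy]

lemma Junta.sum {ι : Type*} {s : Finset ι} {F : ι → (∀ i, V i) → ℝ}
    (H : ∀ i ∈ s, Junta S (F i)) : Junta S (∑ i ∈ s, F i) :=
  fun x y hxy => by
    simp only [Finset.sum_apply]
    exact sum_congr rfl fun i hi => H i hi x y hxy

lemma Junta.smul (hf : Junta S f) (c : ℝ) : Junta S (c • f) :=
  fun x y hxy => by simp [hf x y hxy]

end Junta

/-! ### The averaging operators -/

section Averaging

variable {μ : (∀ i, V i) → ℝ} {S T : Finset (Fin k)} {f g h u : (∀ i, V i) → ℝ}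

lemma Aop_eq_expect (f : (∀ i, V i) → ℝ) (x : ∀ i, V i) :
    Aop μ S f x = expect (cond μ S x) f := rfl

lemma Aop_sub : Aop μ S (f - g) = Aop μ S f - Aop μ S g :=
  funext fun _ => expect_sub

lemma Aop_smul (c : ℝ) : Aop μ S (c • f) = c • Aop μ S f :=
  funext fun _ => expect_smul c

lemma Aop_sum {ι : Type*} (s : Finset ι) (F : ι → (∀ i, V i) → ℝ) :
    Aop μ S (∑ i ∈ s, F i) = ∑ i ∈ s, Aop μ S (F i) :=
  funext fun x => by
    rw [Finset.sum_apply]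
    exact expect_sum s F

lemma marg_nonneg (hμ : IsProb μ) (x : ∀ i, V i) : 0 ≤ marg μ S x :=
  sum_nonneg fun z _ => by split_ifs <;> simp [hμ.1 z]

lemma le_marg (hμ : IsProb μ) {x z : ∀ i, V i} (hz : ∀ i ∈ S, z i = x i) :
    μ z ≤ marg μ S x := by
  have := single_le_sum (f := fun z => if ∀ i ∈ S, z i = x i then μ z else 0)
    (fun z _ => by split_ifs <;> simp [hμ.1 z]) (mem_univ z)
  simpa [marg, if_pos hz] using this

lemma marg_congr {x y : ∀ i, V i} (hxy : ∀ i ∈ S, x i = y i) : marg μ S x = marg μ S y := by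
  refine sum_congr rfl fun z _ => ?_
  have : (∀ i ∈ S, z i = x i) ↔ ∀ i ∈ S, z i = y i :=
    forall₂_congr fun i hi => by rw [hxy i hi]
  simp only [this]

lemma cond_congr {x y : ∀ i, V i} (hxy : ∀ i ∈ S, x i = y i) (z : ∀ i, V i) :
    cond μ S x z = cond μ S y z := by
  have : (∀ i ∈ S, z i = x i) ↔ ∀ i ∈ S, z i = y i :=
    forall₂_congr fun i hi => by rw [hxy i hi]
  simp only [cond, this, marg_congr hxy]

lemma cond_nonneg (hμ : IsProb μ) (x z : ∀ i, V i) : 0 ≤ cond μ S x z := by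
  unfold cond
  split_ifs
  · exact div_nonneg (hμ.1 z) (marg_nonneg hμ x)
  · exact le_rfl

lemma sum_cond {x : ∀ i, V i} (hx : marg μ S x ≠ 0) : ∑ z, cond μ S x z = 1 := by
  have : ∀ z, cond μ S x z = (if ∀ i ∈ S, z i = x i then μ z else 0) / marg μ S x := by
    intro z
    unfold cond
    split_ifs <;> simp
  simp only [this, ← sum_div]
  exact div_self hx

lemma cond_eq_zero {x : ∀ i, V i} (hx : marg μ S x = 0) (z : ∀ i, V i) :
    cond μ S x z = 0 := by
  simp [cond, hx]

lemma isProb_cond (hμ : IsProb μ) {x : ∀ i, V i} (hx : marg μ S x ≠ 0) :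
    IsProb (cond μ S x) :=
  ⟨cond_nonneg hμ x, sum_cond hx⟩

lemma junta_Aop (f : (∀ i, V i) → ℝ) : Junta S (Aop μ S f) :=
  fun _ _ hxy => sum_congr rfl fun z _ => by rw [cond_congr hxy]

lemma Aop_nonneg (hμ : IsProb μ) (hf : ∀ x, 0 ≤ f x) (x : ∀ i, V i) : 0 ≤ Aop μ S f x :=
  sum_nonneg fun z _ => mul_nonneg (cond_nonneg hμ x z) (hf z)

lemma Aop_congr {x : ∀ i, V i} (H : ∀ z, (∀ i ∈ S, z i = x i) → f z = g z) :
    Aop μ S f x = Aop μ S g x := by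
  refine sum_congr rfl fun z _ => ?_
  by_cases hz : ∀ i ∈ S, z i = x i
  · rw [H z hz]
  · simp [cond, hz]

lemma Aop_mul (hu : Junta S u) (f : (∀ i, V i) → ℝ) : Aop μ S (u * f) = u * Aop μ S f := by
  ext x
  have : Aop μ S (u * f) x = Aop μ S (u x • f) x :=
    Aop_congr fun z hz => by simp [hu z x hz]
  rw [this, Aop_smul]
  rfl

lemma Aop_of_junta (hμ : IsProb μ) (hf : Junta S f) {x : ∀ i, V i} (hx : μ x ≠ 0) :
    Aop μ S f x = f x := by
  have hm : marg μ S x ≠ 0 :=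
    ((hμ.1 x).lt_of_ne' hx |>.trans_le (le_marg hμ fun _ _ => rfl)).ne'
  have h1 : Aop μ S f x = Aop μ S (f * 1) x := by rw [mul_one]
  rw [h1, Aop_mul hf, Pi.mul_apply]
  simp [Aop, sum_cond hm]

lemma Aop_sq_le (hμ : IsProb μ) (f : (∀ i, V i) → ℝ) (x : ∀ i, V i) :
    Aop μ S f x ^ 2 ≤ Aop μ S (f ^ 2) x := by
  by_cases hx : marg μ S x = 0
  · simp [Aop, cond_eq_zero hx]
  · have := expect_mul_sq_le (isProb_cond hμ hx) f 1
    simpa [expect, Aop, sum_cond hx] using this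

lemma Aop_Aop (hμ : IsProb μ) (hST : S ⊆ T) (f : (∀ i, V i) → ℝ) :
    Aop μ S (Aop μ T f) = Aop μ S f := by
  ext x
  have key : ∀ w, ∑ z, cond μ S x z * cond μ T z w = cond μ S x w := by
    intro w
    by_cases hw : ∀ i ∈ S, w i = x i
    · have h1 : ∀ z, cond μ S x z * cond μ T z w =
          (μ w / marg μ S x / marg μ T w) * (if ∀ i ∈ T, z i = w i then μ z else 0) := by
        intro z
        by_cases hz : ∀ i ∈ T, z i = w i
        · have hz' : ∀ i ∈ S, z i = x i := fun i hi => (hz i (hST hi)).trans (hw i hi)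
          have hz'' : ∀ i ∈ T, w i = z i := fun i hi => (hz i hi).symm
          rw [cond, if_pos hz', cond, if_pos hz'', if_pos hz, marg_congr hz]
          ring
        · have hz'' : ¬ ∀ i ∈ T, w i = z i := fun H => hz fun i hi => (H i hi).symm
          rw [cond, cond, if_neg hz'', if_neg hz]
          simp
      simp only [h1, ← mul_sum]
      change _ * marg μ T w = _
      rw [cond, if_pos hw]
      by_cases hm : marg μ T w = 0
      · have : μ w = 0 :=
          le_antisymm ((le_marg hμ fun _ _ => rfl).trans_eq hm) (hμ.1 w)
        simp [this]
      · field_simp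
    · rw [cond, if_neg hw]
      refine sum_eq_zero fun z _ => ?_
      by_cases hz : ∀ i ∈ S, z i = x i
      · have : ¬ ∀ i ∈ T, w i = z i := fun H =>
          hw fun i hi => (H i (hST hi)).trans (hz i hi)
        simp [cond, this]
      · simp [cond, hz]
  simp only [Aop, mul_sum]
  rw [sum_comm]
  refine sum_congr rfl fun w _ => ?_
  simp only [← mul_assoc, ← sum_mul, key]

lemma expect_Aop_mul (f g : (∀ i, V i) → ℝ) :
    expect μ (Aop μ S f * g) = expect μ (f * Aop μ S g) := by
  simp only [expect, Pi.mul_apply, Aop, mul_sum, sum_mul]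
  rw [sum_comm]
  refine sum_congr rfl fun z _ => sum_congr rfl fun x _ => ?_
  by_cases hz : ∀ i ∈ S, z i = x i
  · have hz' : ∀ i ∈ S, x i = z i := fun i hi => (hz i hi).symm
    rw [cond, if_pos hz, cond, if_pos hz', marg_congr hz]
    ring
  · have hz' : ¬ ∀ i ∈ S, x i = z i := fun H => hz fun i hi => (H i hi).symm
    simp [cond, hz, hz']

lemma expect_mul_Aop_of_junta (hμ : IsProb μ) (hu : Junta S u) (f : (∀ i, V i) → ℝ) :
    expect μ (u * Aop μ S f) = expect μ (u * f) := by
  rw [← expect_Aop_mul]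
  exact expect_congr fun x hx => by simp [Aop_of_junta hμ hu hx]

lemma expect_Aop (hμ : IsProb μ) (f : (∀ i, V i) → ℝ) :
    expect μ (Aop μ S f) = expect μ f := by
  have := expect_mul_Aop_of_junta (S := S) hμ (u := 1) (fun _ _ _ => rfl) f
  simpa using this

lemma l2norm_Aop_le (hμ : IsProb μ) (f : (∀ i, V i) → ℝ) :
    l2norm μ (Aop μ S f) ≤ l2norm μ f := by
  refine l2norm_le hμ l2norm_nonneg ?_
  rw [l2norm_sq hμ, ← expect_Aop (S := S) hμ (f ^ 2)]
  exact expect_mono hμ fun x _ => Aop_sq_le hμ f x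

lemma sum_Aop_mul_sq_le (hμ : IsProb μ) {ι : Type*} (s : Finset ι)
    (a b : ι → (∀ i, V i) → ℝ) (x : ∀ i, V i) :
    (∑ p ∈ s, Aop μ S (a p * b p) x) ^ 2 ≤
      (∑ p ∈ s, Aop μ S (a p ^ 2) x) * ∑ p ∈ s, Aop μ S (b p ^ 2) x := by
  simp only [Aop, ← sum_product']
  refine sum_sq_le_sum_mul_sum_of_sq_le_mul _ ?_ ?_ ?_
  · exact fun p _ => mul_nonneg (cond_nonneg hμ x _) (sq_nonneg _)
  · exact fun p _ => mul_nonneg (cond_nonneg hμ x _) (sq_nonneg _)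
  · intro p _
    simp only [Pi.mul_apply, Pi.pow_apply]
    exact le_of_eq (by ring)

end Averaging

/-! ### Averaging operators of an `ε`-product measure -/

section EpsProduct

variable {μ : (∀ i, V i) → ℝ} {ε : ℝ} {S T Q R : Finset (Fin k)} {i j : Fin k}
  {f g h : (∀ i, V i) → ℝ}

lemma expect_sub_Aop_sq (hμ : IsProb μ) (f : (∀ i, V i) → ℝ) :
    expect μ ((f - Aop μ S f) ^ 2) = expect μ (Aop μ S (f ^ 2) - Aop μ S f ^ 2) := by
  have h1 : (f - Aop μ S f) ^ 2 =
      f ^ 2 - (2 : ℝ) • (Aop μ S f * f) + Aop μ S f ^ 2 := by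
    ext x
    simp only [Pi.add_apply, Pi.sub_apply, Pi.mul_apply, Pi.pow_apply, Pi.smul_apply,
      smul_eq_mul]
    ring
  have h2 : expect μ (Aop μ S f * f) = expect μ (Aop μ S f ^ 2) := by
    rw [← expect_mul_Aop_of_junta hμ (junta_Aop f), sq]
  rw [h1, expect_add, expect_sub, expect_smul, h2, expect_sub, expect_Aop hμ]
  ring

lemma variance_Aop_insert_le (hμ : IsProb μ) (hP : EpsProduct μ ε)
    (hi : i ∉ Q) (hj : j ∉ Q) (hij : i ≠ j) (hh : Junta (insert i Q) h)
    {x : ∀ i, V i} (hx : 0 < marg μ Q x) :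
    Aop μ Q (Aop μ (insert j Q) h ^ 2) x - Aop μ Q (Aop μ (insert j Q) h) x ^ 2 ≤
      ε ^ 2 * Aop μ Q (h ^ 2) x := by
  have hcard : Q.card ≤ k - 2 := by
    have h1 : (insert i (insert j Q)).card = Q.card + 2 := by
      rw [card_insert_of_notMem, card_insert_of_notMem hj]
      simp [hij, hi]
    have h2 := card_le_univ (insert i (insert j Q))
    rw [Fintype.card_fin] at h2
    omega
  set a := Aop μ (insert j Q) h with ha
  have haj : Junta (insert j Q) a := junta_Aop h
  have hf : ∀ {g : (∀ i, V i) → ℝ} {l : Fin k} {z : ∀ i, V i}, Junta (insert l Q) g →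
      (∀ m ∈ Q, z m = x m) → g (Function.update x l (z l)) = g z := by
    intro g l z hg hz
    refine hg _ _ fun m hm => ?_
    by_cases hml : m = l
    · subst hml; simp
    · rw [Function.update_of_ne hml]
      exact (hz m ((mem_insert.1 hm).resolve_left hml)).symm
  have key := hP Q hcard x hx i j hi hj hij (fun v => h (Function.update x i v))
    (fun v => a (Function.update x j v))
  simp only [← Aop_eq_expect] at key
  have e1 : Aop μ Q (fun z => h (Function.update x i (z i)) * a (Function.update x j (z j))) x =
      Aop μ Q (a ^ 2) x := by
    have : Aop μ Q (a ^ 2) = Aop μ Q (a * h) := by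
      rw [← Aop_Aop hμ (subset_insert j Q) (a * h), Aop_mul haj, ← ha, sq]
    rw [this]
    exact Aop_congr fun z hz => by rw [hf hh hz, hf haj hz, Pi.mul_apply, mul_comm]
  have e2 : Aop μ Q (fun z => h (Function.update x i (z i))) x = Aop μ Q a x := by
    rw [ha, Aop_Aop hμ (subset_insert j Q)]
    exact Aop_congr fun z hz => hf hh hz
  have e3 : Aop μ Q (fun z => a (Function.update x j (z j))) x = Aop μ Q a x :=
    Aop_congr fun z hz => hf haj hz
  have e4 : Aop μ Q (fun z => h (Function.update x i (z i)) ^ 2) x = Aop μ Q (h ^ 2) x :=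
    Aop_congr fun z hz => by rw [hf hh hz, Pi.pow_apply]
  have e5 : Aop μ Q (fun z => a (Function.update x j (z j)) ^ 2) x = Aop μ Q (a ^ 2) x :=
    Aop_congr fun z hz => by rw [hf haj hz, Pi.pow_apply]
  rw [e1, e2, e3, e4, e5] at key
  have hA : 0 ≤ Aop μ Q (a ^ 2) x - Aop μ Q a x ^ 2 := sub_nonneg.2 (Aop_sq_le hμ a x)
  have hH : 0 ≤ Aop μ Q (h ^ 2) x - Aop μ Q a x ^ 2 := by
    rw [ha, Aop_Aop hμ (subset_insert j Q)]
    exact sub_nonneg.2 (Aop_sq_le hμ h x)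
  rw [← sq, abs_of_nonneg hA] at key
  set A := Aop μ Q (a ^ 2) x - Aop μ Q a x ^ 2
  set H := Aop μ Q (h ^ 2) x - Aop μ Q a x ^ 2 with hHdef
  have h3 : A ^ 2 ≤ ε ^ 2 * (H * A) := by
    have := pow_le_pow_left₀ hA key 2
    rwa [mul_pow, Real.sq_sqrt (mul_nonneg hH hA)] at this
  have h4 : A ≤ ε ^ 2 * H := by
    rcases hA.eq_or_lt with h0 | h0
    · rw [← h0]; positivity
    · nlinarith
  exact h4.trans (mul_le_mul_of_nonneg_left (by nlinarith [sq_nonneg (Aop μ Q a x)])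
    (sq_nonneg ε))

lemma l2norm_Aop_insert_sub_le (hμ : IsProb μ) (hε : 0 ≤ ε) (hP : EpsProduct μ ε)
    (hi : i ∉ Q) (hj : j ∉ Q) (hij : i ≠ j) (hh : Junta (insert i Q) h) :
    l2norm μ (Aop μ (insert j Q) h - Aop μ Q h) ≤ ε * l2norm μ h := by
  refine l2norm_le hμ (mul_nonneg hε l2norm_nonneg) ?_
  rw [mul_pow, l2norm_sq hμ, ← expect_Aop (S := Q) hμ (h ^ 2), ← expect_smul,
    ← Aop_Aop hμ (subset_insert j Q) h, expect_sub_Aop_sq hμ]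
  refine expect_mono hμ fun x hx => ?_
  exact variance_Aop_insert_le hμ hP hi hj hij hh (hx.trans_le (le_marg hμ fun _ _ => rfl))

lemma l2norm_Aop_union_sub_le (hμ : IsProb μ) (hε : 0 ≤ ε) (hP : EpsProduct μ ε)
    (hh : Junta (insert i R) h) (D : Finset (Fin k)) (hi : i ∉ R ∪ D) :
    l2norm μ (Aop μ (R ∪ D) h - Aop μ R h) ≤ D.card * ε * l2norm μ h := by
  induction D using Finset.induction_on with
  | empty => simp [l2norm, normSq]
  | insert j D hj ih =>
    rw [union_insert] at hi ⊢
    have hi' : i ∉ R ∪ D := fun H => hi (mem_insert_of_mem H)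
    have hij : i ≠ j := fun H => hi (H ▸ mem_insert_self _ _)
    have ih := ih hi'
    rw [card_insert_of_notMem hj]
    by_cases hjR : j ∈ R ∪ D
    · rw [insert_eq_of_mem hjR]
      refine ih.trans ?_
      gcongr
      · exact l2norm_nonneg
      · simp
    · have h1 := l2norm_Aop_insert_sub_le hμ hε hP hi' hjR hij
        (hh.mono (insert_subset_insert i subset_union_left))
      have h2 := l2norm_add_le hμ (Aop μ (insert j (R ∪ D)) h - Aop μ (R ∪ D) h)
        (Aop μ (R ∪ D) h - Aop μ R h)
      rw [sub_add_sub_cancel] at h2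
      push_cast
      linarith

lemma l2norm_Aop_sub_le_of_notMem (hμ : IsProb μ) (hε : 0 ≤ ε) (hP : EpsProduct μ ε)
    (hh : Junta (insert i R) h) (hRQ : R ⊆ Q) (hi : i ∉ Q) :
    l2norm μ (Aop μ Q h - Aop μ R h) ≤ k * ε * l2norm μ h := by
  have h1 := l2norm_Aop_union_sub_le hμ hε hP hh (Q \ R) (by rwa [union_sdiff_of_subset hRQ])
  rw [union_sdiff_of_subset hRQ] at h1
  refine h1.trans ?_
  gcongr
  · exact l2norm_nonneg
  · simpa using card_le_univ (Q \ R)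

lemma l2norm_Aop_sub_Aop_inter_le (hμ : IsProb μ) (hε : 0 ≤ ε) (hP : EpsProduct μ ε)
    (hh : Junta T h) (S : Finset (Fin k)) :
    l2norm μ (Aop μ S h - Aop μ (S ∩ T) h) ≤ (k : ℝ) ^ 2 * ε * l2norm μ h := by
  have main : ∀ (n : ℕ) (T : Finset (Fin k)) (h : (∀ i, V i) → ℝ), Junta T h →
      (T \ S).card = n →
      l2norm μ (Aop μ S h - Aop μ (S ∩ T) h) ≤ n * (k * ε) * l2norm μ h := by
    intro n
    induction n with
    | zero =>
      intro T h hh hn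
      rw [card_eq_zero, sdiff_eq_empty_iff_subset] at hn
      have : l2norm μ (Aop μ S h - Aop μ (S ∩ T) h) = l2norm μ (0 : (∀ i, V i) → ℝ) :=
        l2norm_congr fun x hx => by
          rw [inter_eq_right.2 hn]
          simp [Aop_of_junta hμ hh hx, Aop_of_junta hμ (hh.mono hn) hx]
      rw [this]
      simp [l2norm, normSq]
    | succ n ih =>
      intro T h hh hn
      obtain ⟨i, hi⟩ : (T \ S).Nonempty := by
        rw [← card_pos]; omega
      obtain ⟨hiT, hiS⟩ := mem_sdiff.1 hi
      have hn' : (T.erase i \ S).card = n := by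
        rw [erase_sdiff_comm, card_erase_of_mem hi, hn]; rfl
      have h1 := ih (T.erase i) (Aop μ (T.erase i) h) (junta_Aop h) hn'
      have hST : S ∩ T.erase i = S ∩ T := by
        rw [inter_erase, erase_eq_of_notMem]
        simp [hiS]
      rw [Aop_Aop hμ inter_subset_right, hST] at h1
      have h2 := l2norm_Aop_sub_le_of_notMem (Q := S ∪ T.erase i) hμ hε hP
        (by rwa [insert_erase hiT]) subset_union_right (by simp [hiS])
      have h3 := (l2norm_Aop_le (S := S) hμ _).trans h2
      rw [Aop_sub, Aop_Aop hμ subset_union_left] at h3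
      have h4 := l2norm_add_le hμ (Aop μ S h - Aop μ S (Aop μ (T.erase i) h))
        (Aop μ S (Aop μ (T.erase i) h) - Aop μ (S ∩ T) h)
      rw [sub_add_sub_cancel] at h4
      have h5 : n * (k * ε) * l2norm μ (Aop μ (T.erase i) h) ≤ n * (k * ε) * l2norm μ h :=
        mul_le_mul_of_nonneg_left (l2norm_Aop_le hμ h) (by positivity)
      push_cast
      linarith
  refine (main _ T h hh rfl).trans ?_
  rw [sq, mul_assoc (k : ℝ)]
  gcongr
  · exact l2norm_nonneg
  · simpa using card_le_univ (T \ S)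

/-- Correlations of juntas are approximately determined by their common coordinates. -/
lemma abs_expect_mul_sub_le (hμ : IsProb μ) (hε : 0 ≤ ε) (hP : EpsProduct μ ε)
    (hf : Junta S f) (hg : Junta T g) :
    |expect μ (f * g) - expect μ (Aop μ (S ∩ T) f * g)| ≤
      (k : ℝ) ^ 2 * ε * l2norm μ f * l2norm μ g := by
  have h1 : expect μ (f * g) - expect μ (Aop μ (S ∩ T) f * g) =
      expect μ ((Aop μ T f - Aop μ (T ∩ S) f) * g) := by
    rw [sub_mul, expect_sub, inter_comm T S, mul_comm (Aop μ T f),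
      expect_mul_Aop_of_junta hμ hg, mul_comm g]
  rw [h1]
  exact (abs_expect_mul_le hμ _ _).trans (mul_le_mul_of_nonneg_right
    (l2norm_Aop_sub_Aop_inter_le hμ hε hP hf T) l2norm_nonneg)

lemma expect_mul_le_expect_Aop (hμ : IsProb μ) (hε : 0 ≤ ε) (hP : EpsProduct μ ε)
    (hf : Junta S f) (hg : Junta T g) :
    expect μ (f * g) ≤ expect μ (Aop μ (S ∩ T) f * Aop μ (S ∩ T) g) +
      (k : ℝ) ^ 2 * ε * l2norm μ f * l2norm μ g := by
  rw [expect_mul_Aop_of_junta hμ (junta_Aop f)]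
  linarith [le_of_abs_le (abs_expect_mul_sub_le hμ hε hP hf hg)]

lemma expect_Aop_mul_Aop_le (hμ : IsProb μ) (hε : 0 ≤ ε) (hP : EpsProduct μ ε)
    (hf : Junta S f) (hg : Junta T g) (R : Finset (Fin k)) :
    expect μ (Aop μ R f * Aop μ R g) ≤
      expect μ (Aop μ (S ∩ T ∩ R) f * Aop μ (S ∩ T ∩ R) g) +
        3 * ((k : ℝ) ^ 2 * ε * l2norm μ f * l2norm μ g) := by
  have hc : 0 ≤ (k : ℝ) ^ 2 * ε := by positivity
  have hf0 : 0 ≤ l2norm μ f := l2norm_nonneg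
  have hg0 : 0 ≤ l2norm μ g := l2norm_nonneg
  have h1 : expect μ ((Aop μ R f - Aop μ (R ∩ S) f) * Aop μ R g) ≤
      (k : ℝ) ^ 2 * ε * l2norm μ f * l2norm μ g :=
    (le_of_abs_le (abs_expect_mul_le hμ _ _)).trans (mul_le_mul
      (l2norm_Aop_sub_Aop_inter_le hμ hε hP hf R) (l2norm_Aop_le hμ g) l2norm_nonneg
      (by positivity))
  have h2 : expect μ ((Aop μ R g - Aop μ (R ∩ T) g) * Aop μ (R ∩ S) f) ≤
      (k : ℝ) ^ 2 * ε * l2norm μ g * l2norm μ f :=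
    (le_of_abs_le (abs_expect_mul_le hμ _ _)).trans (mul_le_mul
      (l2norm_Aop_sub_Aop_inter_le hμ hε hP hg R) (l2norm_Aop_le hμ f) l2norm_nonneg
      (by positivity))
  have h3 := expect_mul_le_expect_Aop hμ hε hP (junta_Aop (μ := μ) (S := R ∩ S) f)
    (junta_Aop (μ := μ) (S := R ∩ T) g)
  have h4 : R ∩ S ∩ (R ∩ T) = S ∩ T ∩ R := by
    ext; simp only [mem_inter]; tauto
  rw [h4, Aop_Aop hμ (by intro; simp only [mem_inter]; tauto),
    Aop_Aop hμ (by intro; simp only [mem_inter]; tauto)] at h3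
  have h5 : (k : ℝ) ^ 2 * ε * l2norm μ (Aop μ (R ∩ S) f) * l2norm μ (Aop μ (R ∩ T) g) ≤
      (k : ℝ) ^ 2 * ε * l2norm μ f * l2norm μ g :=
    mul_le_mul (mul_le_mul_of_nonneg_left (l2norm_Aop_le hμ f) hc) (l2norm_Aop_le hμ g)
      l2norm_nonneg (by positivity)
  rw [sub_mul, expect_sub] at h1 h2
  rw [mul_comm (Aop μ R g), mul_comm (Aop μ (R ∩ T) g)] at h2
  nlinarith

end EpsProduct

/-! ### Alternating sums over subsets -/

section AlternatingSum

variable {α : Type*} [DecidableEq α]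

/-- The alternating sum `∑_{P ⊆ Y} (-1)^{|Y ∖ P|} a P`. -/
def altSum (Y : Finset α) (a : Finset α → ℝ) : ℝ :=
  ∑ P ∈ Y.powerset, (-1 : ℝ) ^ (Y.card - P.card) * a P

lemma altSum_insert {i : α} {Y : Finset α} (hi : i ∉ Y) (a : Finset α → ℝ) :
    altSum (insert i Y) a = altSum Y fun P => a (insert i P) - a P := by
  rw [altSum, sum_powerset_insert hi, altSum, ← sum_add_distrib]
  refine sum_congr rfl fun P hP => ?_
  have hPY := mem_powerset.1 hP
  have hiP : i ∉ P := fun H => hi (hPY H)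
  have hc := card_le_card hPY
  rw [card_insert_of_notMem hi, card_insert_of_notMem hiP, Nat.add_sub_add_right,
    Nat.sub_add_comm hc, pow_succ]
  ring

lemma altSum_sub (Y : Finset α) (a b : Finset α → ℝ) :
    altSum Y (fun P => a P - b P) = altSum Y a - altSum Y b := by
  simp only [altSum, mul_sub, sum_sub_distrib]

lemma altSum_congr {Y : Finset α} {a b : Finset α → ℝ} (H : ∀ P ⊆ Y, a P = b P) :
    altSum Y a = altSum Y b :=
  sum_congr rfl fun P hP => by rw [H P (mem_powerset.1 hP)]

lemma altSum_union {W Y : Finset α} (hWY : Disjoint W Y) (a : Finset α → ℝ) :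
    altSum (W ∪ Y) a = altSum W fun R => altSum Y fun P => a (R ∪ P) := by
  induction W using Finset.induction_on generalizing a with
  | empty => simp [altSum]
  | insert i W hi ih =>
    rw [disjoint_insert_left] at hWY
    have hi' : i ∉ W ∪ Y := by simp [hi, hWY.1]
    rw [insert_union, altSum_insert hi', ih hWY.2, altSum_insert hi]
    refine altSum_congr fun R _ => ?_
    rw [altSum_sub]
    simp only [insert_union]

lemma sum_pow_mul_altSum (U : Finset α) (r : ℝ) (a : Finset α → ℝ) :
    ∑ Y ∈ U.powerset, r ^ Y.card * altSum Y a =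
      ∑ P ∈ U.powerset, r ^ P.card * (1 - r) ^ (U.card - P.card) * a P := by
  induction U using Finset.induction_on generalizing a with
  | empty => simp [altSum]
  | insert i U hi ih =>
    rw [sum_powerset_insert hi, sum_powerset_insert hi]
    have h1 : ∑ Y ∈ U.powerset, r ^ (insert i Y).card * altSum (insert i Y) a =
        r * (∑ Y ∈ U.powerset, r ^ Y.card * altSum Y fun P => a (insert i P)) -
          r * ∑ Y ∈ U.powerset, r ^ Y.card * altSum Y a := by
      rw [mul_sum, mul_sum, ← sum_sub_distrib]
      refine sum_congr rfl fun Y hY => ?_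
      have hiY : i ∉ Y := fun H => hi (mem_powerset.1 hY H)
      rw [card_insert_of_notMem hiY, altSum_insert hiY, altSum_sub]
      ring
    rw [h1, ih, ih, ← sub_eq_zero]
    simp only [mul_sum, ← sum_sub_distrib, ← sum_add_distrib]
    refine sum_eq_zero fun P hP => ?_
    have hPU := mem_powerset.1 hP
    have hiP : i ∉ P := fun H => hi (hPU H)
    rw [card_insert_of_notMem hi, card_insert_of_notMem hiP, Nat.add_sub_add_right,
      Nat.sub_add_comm (card_le_card hPU), pow_succ, pow_succ]
    ring

lemma sum_altSum (U : Finset α) (a : Finset α → ℝ) :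
    ∑ Y ∈ U.powerset, altSum Y a = a U := by
  have := sum_pow_mul_altSum U 1 a
  simp only [one_pow, one_mul, sub_self] at this
  rw [this, sum_eq_single U]
  · simp
  · intro P hP hPU
    have := card_lt_card ((mem_powerset.1 hP).ssubset_of_ne hPU)
    rw [zero_pow (by omega), zero_mul]
  · simp

lemma abs_altSum_le {Y : Finset α} {a : Finset α → ℝ} {B : ℝ} (H : ∀ P ⊆ Y, |a P| ≤ B) :
    |altSum Y a| ≤ 2 ^ Y.card * B := by
  refine (abs_sum_le_sum_abs _ _).trans ((sum_le_card_nsmul _ _ B fun P hP => ?_).trans_eq ?_)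
  · rw [abs_mul, abs_pow, abs_neg, abs_one, one_pow, one_mul]
    exact H P (mem_powerset.1 hP)
  · rw [card_powerset, nsmul_eq_mul]
    push_cast
    rfl

lemma altSum_sq_le (Y : Finset α) (a : Finset α → ℝ) :
    altSum Y a ^ 2 ≤ 2 ^ Y.card * ∑ P ∈ Y.powerset, a P ^ 2 := by
  refine (sq_sum_le_card_mul_sum_sq).trans_eq ?_
  rw [card_powerset]
  push_cast
  congr 1
  refine sum_congr rfl fun P _ => ?_
  rw [mul_pow, ← pow_mul, mul_comm _ 2, pow_mul, neg_one_sq, one_pow, one_mul]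

end AlternatingSum

/-! ### Relative Efron–Stein components -/

section EfronStein

variable {μ : (∀ i, V i) → ℝ} {ε : ℝ} {S T Q R Y Y' : Finset (Fin k)} {i : Fin k}
  {f g u : (∀ i, V i) → ℝ}

/-- The Efron–Stein component of `f` in the coordinates `Y`, relative to the coordinates `R`. -/
noncomputable def relES (μ : (∀ i, V i) → ℝ) (R Y : Finset (Fin k)) (f : (∀ i, V i) → ℝ)
    (x : ∀ i, V i) : ℝ :=
  altSum Y fun P => Aop μ (R ∪ P) f x

lemma relES_empty (Y : Finset (Fin k)) (f : (∀ i, V i) → ℝ) :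
    relES μ ∅ Y f = ES μ Y f := by
  ext x
  simp [relES, ES, altSum]

lemma relES_eq_sum (R Y : Finset (Fin k)) (f : (∀ i, V i) → ℝ) :
    relES μ R Y f =
      ∑ P ∈ Y.powerset, ((-1 : ℝ) ^ (Y.card - P.card)) • Aop μ (R ∪ P) f := by
  ext x
  simp [relES, altSum, Finset.sum_apply]

lemma junta_relES (R Y : Finset (Fin k)) (f : (∀ i, V i) → ℝ) :
    Junta (R ∪ Y) (relES μ R Y f) := by
  rw [relES_eq_sum]
  exact Junta.sum fun P hP => ((junta_Aop f).mono
    (union_subset_union_right (mem_powerset.1 hP))).smul _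

lemma junta_ES (Y : Finset (Fin k)) (f : (∀ i, V i) → ℝ) : Junta Y (ES μ Y f) := by
  have := junta_relES (μ := μ) ∅ Y f
  rwa [relES_empty, empty_union] at this

lemma relES_mul (hu : Junta R u) (f : (∀ i, V i) → ℝ) :
    relES μ R Y (u * f) = u * relES μ R Y f := by
  ext x
  simp only [relES, altSum, Pi.mul_apply, mul_sum]
  refine sum_congr rfl fun P _ => ?_
  rw [Aop_mul (hu.mono subset_union_left), Pi.mul_apply]
  ring

lemma card_subset_le (S : Finset (Fin k)) : S.card ≤ k := by
  simpa using card_le_univ S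

lemma two_pow_card_le (S : Finset (Fin k)) : (2 : ℝ) ^ S.card ≤ 2 ^ k :=
  pow_le_pow_right₀ one_le_two (card_subset_le S)

lemma l2norm_relES_le (hμ : IsProb μ) (R Y : Finset (Fin k)) (f : (∀ i, V i) → ℝ) :
    l2norm μ (relES μ R Y f) ≤ 2 ^ k * l2norm μ f := by
  rw [relES_eq_sum]
  refine (l2norm_sum_le_card hμ (a := l2norm μ f) _ _ fun P _ => ?_).trans ?_
  · rw [l2norm_smul, abs_pow, abs_neg, abs_one, one_pow, one_mul]
    exact l2norm_Aop_le hμ f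
  · rw [card_powerset]
    push_cast
    exact mul_le_mul_of_nonneg_right (two_pow_card_le Y) l2norm_nonneg

lemma l2norm_Aop_relES_le (hμ : IsProb μ) (hε : 0 ≤ ε) (hP : EpsProduct μ ε)
    (hiY : i ∈ Y) (hiR : i ∉ R) (f : (∀ i, V i) → ℝ) :
    l2norm μ (Aop μ (univ.erase i) (relES μ R Y f)) ≤ 2 ^ k * (k * ε * l2norm μ f) := by
  have hiQ : i ∉ univ.erase i := notMem_erase _ _
  have h1 : relES μ R Y f = ∑ P ∈ (Y.erase i).powerset,
      ((-1 : ℝ) ^ ((Y.erase i).card - P.card)) •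
        (Aop μ (insert i (R ∪ P)) f - Aop μ (R ∪ P) f) := by
    ext x
    rw [relES, ← insert_erase hiY, altSum_insert (notMem_erase i Y)]
    simp [altSum, Finset.sum_apply, union_insert]
  rw [h1, Aop_sum]
  refine (l2norm_sum_le_card hμ (a := k * ε * l2norm μ f) _ _ fun P hPY => ?_).trans ?_
  · have hiRP : i ∉ R ∪ P := by
      rw [mem_union, not_or]
      exact ⟨hiR, fun H => notMem_erase i Y (mem_powerset.1 hPY H)⟩
    have hRPQ : R ∪ P ⊆ univ.erase i := fun j hj =>
      mem_erase.2 ⟨fun H => hiRP (H ▸ hj), mem_univ j⟩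
    rw [Aop_smul, l2norm_smul, abs_pow, abs_neg, abs_one, one_pow, one_mul, Aop_sub]
    have h2 : l2norm μ (Aop μ (univ.erase i) (Aop μ (insert i (R ∪ P)) f) -
          Aop μ (univ.erase i) (Aop μ (R ∪ P) f)) =
        l2norm μ (Aop μ (univ.erase i) (Aop μ (insert i (R ∪ P)) f) -
          Aop μ (R ∪ P) (Aop μ (insert i (R ∪ P)) f)) :=
      l2norm_congr fun x hx => by
        rw [Aop_Aop hμ (subset_insert _ _)]
        simp [Aop_of_junta hμ ((junta_Aop (S := R ∪ P) f).mono hRPQ) hx]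
    rw [h2]
    refine (l2norm_Aop_sub_le_of_notMem hμ hε hP (junta_Aop f) hRPQ hiQ).trans ?_
    exact mul_le_mul_of_nonneg_left (l2norm_Aop_le hμ f) (by positivity)
  · rw [card_powerset]
    push_cast
    have : 0 ≤ l2norm μ f := l2norm_nonneg
    exact mul_le_mul_of_nonneg_right (two_pow_card_le _) (by positivity)

lemma abs_expect_relES_mul_le (hμ : IsProb μ) (hε : 0 ≤ ε) (hP : EpsProduct μ ε)
    (hiY : i ∈ Y) (hiR : i ∉ R) (f : (∀ i, V i) → ℝ) (hu : Junta S u) (hiS : i ∉ S) :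
    |expect μ (relES μ R Y f * u)| ≤ 2 ^ k * (k * ε * l2norm μ f) * l2norm μ u := by
  have hu' : Junta (univ.erase i) u :=
    hu.mono fun j hj => mem_erase.2 ⟨fun H => hiS (H ▸ hj), mem_univ j⟩
  rw [mul_comm, ← expect_mul_Aop_of_junta hμ hu', mul_comm]
  exact (abs_expect_mul_le hμ _ _).trans (mul_le_mul_of_nonneg_right
    (l2norm_Aop_relES_le hμ hε hP hiY hiR f) l2norm_nonneg)

lemma abs_expect_relES_mul_relES_le (hμ : IsProb μ) (hε : 0 ≤ ε) (hP : EpsProduct μ ε)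
    (hY : Disjoint R Y) (hY' : Disjoint R Y') (hne : Y ≠ Y') (f : (∀ i, V i) → ℝ) :
    |expect μ (relES μ R Y f * relES μ R Y' f)| ≤ 4 ^ k * (k * ε) * expect μ (f ^ 2) := by
  have main : ∀ {Y Y' : Finset (Fin k)}, Disjoint R Y → ∀ {i : Fin k}, i ∈ Y → i ∉ Y' →
      |expect μ (relES μ R Y f * relES μ R Y' f)| ≤ 4 ^ k * (k * ε) * expect μ (f ^ 2) := by
    intro Y Y' hY i hi hi'
    have hiR : i ∉ R := fun H => disjoint_left.1 hY H hi
    refine (abs_expect_relES_mul_le hμ hε hP hi hiR f (junta_relES R Y' f)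
      (by simp [hiR, hi'])).trans ?_
    have h0 : 0 ≤ l2norm μ f := l2norm_nonneg
    calc 2 ^ k * (k * ε * l2norm μ f) * l2norm μ (relES μ R Y' f)
        ≤ 2 ^ k * (k * ε * l2norm μ f) * (2 ^ k * l2norm μ f) :=
          mul_le_mul_of_nonneg_left (l2norm_relES_le hμ R Y' f) (by positivity)
      _ = 4 ^ k * (k * ε) * expect μ (f ^ 2) := by
          rw [← l2norm_sq hμ, show (4 : ℝ) = 2 * 2 by norm_num, mul_pow]
          ring
  by_cases hsub : Y ⊆ Y'
  · obtain ⟨i, hi, hi'⟩ := exists_of_ssubset (hsub.ssubset_of_ne hne)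
    rw [mul_comm]
    exact main hY' hi hi'
  · obtain ⟨i, hi, hi'⟩ := not_subset.1 hsub
    exact main hY hi hi'

/-- Approximate orthogonality of the relative Efron–Stein components. -/
lemma abs_expect_sum_relES_le (hμ : IsProb μ) (hε : 0 ≤ ε) (hP : EpsProduct μ ε)
    (R : Finset (Fin k)) (f : (∀ i, V i) → ℝ) {a b : Finset (Fin k) → ℝ}
    (ha : ∀ Y, |a Y| ≤ 1) (hb : ∀ Y, |b Y| ≤ 1) :
    |expect μ ((∑ Y ∈ Rᶜ.powerset, a Y • relES μ R Y f) *
        ∑ Y ∈ Rᶜ.powerset, b Y • relES μ R Y f) -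
      ∑ Y ∈ Rᶜ.powerset, a Y * b Y * expect μ (relES μ R Y f ^ 2)| ≤
      16 ^ k * (k * ε) * expect μ (f ^ 2) := by
  have hf : 0 ≤ expect μ (f ^ 2) := normSq_nonneg hμ f
  set e := 4 ^ k * (k * ε) * expect μ (f ^ 2) with he
  have he0 : 0 ≤ e := by positivity
  have h1 : ∑ Y ∈ Rᶜ.powerset, a Y * b Y * expect μ (relES μ R Y f ^ 2) =
      ∑ Y ∈ Rᶜ.powerset, ∑ Y' ∈ Rᶜ.powerset,
        if Y = Y' then a Y * b Y * expect μ (relES μ R Y f ^ 2) else 0 :=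
    sum_congr rfl fun Y hY => by rw [sum_ite_eq, if_pos hY]
  rw [sum_mul_sum, expect_sum, h1, ← sum_sub_distrib]
  have hterm : ∀ Y ∈ Rᶜ.powerset, ∀ Y' ∈ Rᶜ.powerset,
      |expect μ ((a Y • relES μ R Y f) * (b Y' • relES μ R Y' f)) -
        if Y = Y' then a Y * b Y * expect μ (relES μ R Y f ^ 2) else 0| ≤ e := by
    intro Y hY Y' hY'
    rw [smul_mul_smul_comm, expect_smul]
    split_ifs with h
    · subst h
      rw [← sq, sub_self, abs_zero]
      exact he0
    · rw [sub_zero, abs_mul, abs_mul]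
      have h2 := abs_expect_relES_mul_relES_le hμ hε hP
        (disjoint_compl_right.mono_right (mem_powerset.1 hY))
        (disjoint_compl_right.mono_right (mem_powerset.1 hY')) h f
      calc |a Y| * |b Y'| * |expect μ (relES μ R Y f * relES μ R Y' f)| ≤ 1 * 1 * e := by
            gcongr
            · exact ha Y
            · exact hb Y'
        _ = e := by ring
  have hcard : ((Rᶜ.powerset.card : ℕ) : ℝ) ≤ 2 ^ k := by
    rw [card_powerset]
    push_cast
    exact two_pow_card_le _
  calc _ ≤ ∑ Y ∈ Rᶜ.powerset, ∑ Y' ∈ Rᶜ.powerset, e := by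
        refine (abs_sum_le_sum_abs _ _).trans (sum_le_sum fun Y hY => ?_)
        rw [expect_sum, ← sum_sub_distrib]
        exact (abs_sum_le_sum_abs _ _).trans (sum_le_sum fun Y' hY' => hterm Y hY Y' hY')
    _ = (Rᶜ.powerset.card : ℝ) * ((Rᶜ.powerset.card : ℝ) * e) := by simp
    _ ≤ 2 ^ k * (2 ^ k * e) := by gcongr
    _ = 16 ^ k * (k * ε) * expect μ (f ^ 2) := by
        rw [he, show (16 : ℝ) = 2 * 2 * 4 by norm_num, mul_pow, mul_pow]
        ring

lemma expect_congr_sum_relES (hμ : IsProb μ) (R : Finset (Fin k)) (f g : (∀ i, V i) → ℝ) :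
    expect μ ((∑ Y ∈ Rᶜ.powerset, (1 : ℝ) • relES μ R Y f) * g) = expect μ (f * g) := by
  refine expect_congr fun x hx => ?_
  have h1 : (∑ Y ∈ Rᶜ.powerset, (1 : ℝ) • relES μ R Y f) x = f x := by
    simp only [one_smul, Finset.sum_apply, relES]
    rw [sum_altSum, union_compl]
    exact Aop_of_junta hμ (fun x y hxy => by
      rw [show x = y from funext fun i => hxy i (mem_univ i)]) hx
  rw [Pi.mul_apply, Pi.mul_apply, h1]

/-- Approximate Bessel inequality. -/
lemma sum_expect_relES_sq_le (hμ : IsProb μ) (hε : 0 ≤ ε) (hP : EpsProduct μ ε)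
    (R : Finset (Fin k)) (f : (∀ i, V i) → ℝ) :
    ∑ Y ∈ Rᶜ.powerset, expect μ (relES μ R Y f ^ 2) ≤
      (1 + 16 ^ k * (k * ε)) * expect μ (f ^ 2) := by
  have h1 := abs_expect_sum_relES_le hμ hε hP R f (a := fun _ => 1) (b := fun _ => 1)
    (by simp) (by simp)
  rw [expect_congr_sum_relES hμ, mul_comm f, expect_congr_sum_relES hμ, ← sq] at h1
  simp only [one_mul] at h1
  linarith [neg_le_of_abs_le h1]

end EfronStein

/-! ### Energies of the links of a global function -/

section Energy

variable {μ : (∀ i, V i) → ℝ} {ε δ : ℝ} {d : ℕ} {R T W Y : Finset (Fin k)}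
  {f u : (∀ i, V i) → ℝ}

lemma IsGlobal.Aop_sq_le (hμ : IsProb μ) (hf : IsGlobal μ d δ f) (hδ : 0 ≤ δ)
    (hT : T.card ≤ d) (x : ∀ i, V i) : Aop μ T (f ^ 2) x ≤ δ ^ 2 := by
  by_cases hx : marg μ T x = 0
  · simp [Aop, cond_eq_zero hx, sq_nonneg]
  · have h1 := hf T hT x ((marg_nonneg hμ x).lt_of_ne' hx)
    exact (Real.sqrt_le_left hδ).1 h1

lemma abs_relES_le (hμ : IsProb μ) (hf : IsGlobal μ d δ f) (hδ : 0 ≤ δ)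
    (hRY : (R ∪ Y).card ≤ d) (x : ∀ i, V i) : |relES μ R Y f x| ≤ 2 ^ k * δ := by
  refine (abs_altSum_le (B := δ) fun P hP => ?_).trans
    (mul_le_mul_of_nonneg_right (two_pow_card_le Y) hδ)
  have hc := (card_le_card (union_subset_union_right (s := R) hP)).trans hRY
  exact abs_le_of_sq_le_sq ((GLL.Aop_sq_le hμ f x).trans (hf.Aop_sq_le hμ hδ hc x)) hδ

lemma abs_ES_le (hμ : IsProb μ) (hf : IsGlobal μ d δ f) (hδ : 0 ≤ δ)
    (hT : T.card ≤ d) (x : ∀ i, V i) : |ES μ T f x| ≤ 2 ^ k * δ := by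
  rw [← relES_empty]
  exact abs_relES_le hμ hf hδ (by rwa [empty_union]) x

lemma l2norm_relES_sq_le (hμ : IsProb μ) (hf : IsGlobal μ d δ f) (hδ : 0 ≤ δ)
    (hRY : (R ∪ Y).card ≤ d) :
    l2norm μ (relES μ R Y f ^ 2) ≤ 4 ^ k * δ * l2norm μ f := by
  rw [sq]
  refine (l2norm_mul_le hμ (abs_relES_le hμ hf hδ hRY)).trans ?_
  calc 2 ^ k * δ * l2norm μ (relES μ R Y f) ≤ 2 ^ k * δ * (2 ^ k * l2norm μ f) :=
        mul_le_mul_of_nonneg_left (l2norm_relES_le hμ R Y f) (by positivity)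
    _ = 4 ^ k * δ * l2norm μ f := by
        rw [show (4 : ℝ) = 2 * 2 by norm_num, mul_pow]
        ring

lemma ES_sq_le_sum_relES_sq (hWT : W ⊆ T) (x : ∀ i, V i) :
    ES μ T f x ^ 2 ≤ 2 ^ W.card * ∑ R ∈ W.powerset, relES μ R (T \ W) f x ^ 2 := by
  have h1 : ES μ T f x = altSum W fun R => relES μ R (T \ W) f x := by
    have := altSum_union (disjoint_sdiff (s := W) (t := T)) fun P => Aop μ P f x
    rw [union_sdiff_of_subset hWT] at this
    exact this
  rw [h1]
  exact altSum_sq_le W _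

lemma sum_expect_Aop_mul_relES_sq_le (hμ : IsProb μ) (hε : 0 ≤ ε) (hP : EpsProduct μ ε)
    (hf : IsGlobal μ d δ f) (hδ : 0 ≤ δ) (hk : 16 ^ k * (k * ε) ≤ 1) (hR : R.card ≤ d)
    (hu : ∀ x, 0 ≤ u x) :
    ∑ Y ∈ Rᶜ.powerset, expect μ (Aop μ R u * relES μ R Y f ^ 2) ≤
      2 * δ ^ 2 * expect μ u := by
  set v : (∀ i, V i) → ℝ := fun x => Real.sqrt (Aop μ R u x) with hv
  have hvj : Junta R v := (junta_Aop u).comp Real.sqrt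
  have hv2 : v ^ 2 = Aop μ R u := funext fun x => Real.sq_sqrt (Aop_nonneg hμ hu x)
  have h1 : ∀ Y, Aop μ R u * relES μ R Y f ^ 2 = relES μ R Y (v * f) ^ 2 := fun Y => by
    rw [relES_mul hvj, mul_pow, hv2]
  simp only [h1]
  refine (sum_expect_relES_sq_le hμ hε hP R (v * f)).trans ?_
  have h2 : expect μ ((v * f) ^ 2) ≤ δ ^ 2 * expect μ u := by
    rw [mul_pow, hv2, ← expect_mul_Aop_of_junta hμ (junta_Aop u), ← expect_Aop (S := R) hμ u,
      ← expect_smul]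
    refine expect_mono hμ fun x _ => ?_
    simp only [Pi.mul_apply, Pi.smul_apply, smul_eq_mul]
    rw [mul_comm]
    exact mul_le_mul_of_nonneg_right (hf.Aop_sq_le hμ hδ hR x) (Aop_nonneg hμ hu x)
  have h3 : 0 ≤ expect μ ((v * f) ^ 2) := normSq_nonneg hμ _
  nlinarith

/-- The sets of at most `d` coordinates. -/
def lowSets (k d : ℕ) : Finset (Finset (Fin k)) := univ.filter fun T => T.card ≤ d

lemma mem_lowSets : T ∈ lowSets k d ↔ T.card ≤ d := by simp [lowSets]

lemma card_lowSets_le (k d : ℕ) : ((lowSets k d).card : ℝ) ≤ 2 ^ k := by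
  have := card_le_univ (lowSets k d)
  rw [Fintype.card_finset, Fintype.card_fin] at this
  exact_mod_cast this

/-- Approximate Bessel inequality for the part of a global function depending on `W`,
with a weight depending only on `W`. -/
lemma sum_expect_mul_ES_sq_le (hμ : IsProb μ) (hε : 0 ≤ ε) (hP : EpsProduct μ ε)
    (hf : IsGlobal μ d δ f) (hδ : 0 ≤ δ) (hk : 16 ^ k * (k * ε) ≤ 1) (hW : W.card ≤ d)
    (hu : ∀ x, 0 ≤ u x) (huW : Junta W u) :
    ∑ T ∈ (lowSets k d).filter (W ⊆ ·), expect μ (u * ES μ T f ^ 2) ≤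
      2 * 4 ^ d * δ ^ 2 * expect μ u +
        8 ^ k * ((k : ℝ) ^ 2 * ε * l2norm μ u * (4 ^ k * δ * l2norm μ f)) := by
  have hu0 : 0 ≤ l2norm μ u := l2norm_nonneg
  have hf0 : 0 ≤ l2norm μ f := l2norm_nonneg
  have hE : 0 ≤ expect μ u := expect_nonneg hμ hu
  set e := (k : ℝ) ^ 2 * ε * l2norm μ u * (4 ^ k * δ * l2norm μ f) with he
  have he0 : 0 ≤ e := by positivity
  set 𝒯 := (lowSets k d).filter (W ⊆ ·) with h𝒯
  have hT𝒯 : ∀ T ∈ 𝒯, T.card ≤ d ∧ W ⊆ T := fun T hT => by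
    rw [h𝒯, mem_filter, mem_lowSets] at hT
    exact hT
  have h𝒯c : (𝒯.card : ℝ) ≤ 2 ^ k :=
    (Nat.cast_le.2 (card_le_card (filter_subset _ _))).trans (card_lowSets_le k d)
  have h1 : ∀ T ∈ 𝒯, expect μ (u * ES μ T f ^ 2) ≤
      2 ^ W.card * ∑ R ∈ W.powerset, (expect μ (Aop μ R u * relES μ R (T \ W) f ^ 2) + e) := by
    intro T hT
    obtain ⟨hTd, hWT⟩ := hT𝒯 T hT
    have h2 : expect μ (u * ES μ T f ^ 2) ≤
        2 ^ W.card * ∑ R ∈ W.powerset, expect μ (u * relES μ R (T \ W) f ^ 2) := by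
      rw [← expect_sum, ← expect_smul]
      refine expect_mono hμ fun x _ => ?_
      have := mul_le_mul_of_nonneg_left (ES_sq_le_sum_relES_sq (μ := μ) (f := f) hWT x) (hu x)
      simp only [Pi.mul_apply, Pi.pow_apply, Pi.smul_apply, smul_eq_mul, Finset.sum_apply,
        ← mul_sum]
      linarith
    refine h2.trans (mul_le_mul_of_nonneg_left (sum_le_sum fun R hR => ?_) (by positivity))
    have hRW := mem_powerset.1 hR
    have hcard : (R ∪ T \ W).card ≤ d :=
      (card_le_card (union_subset (hRW.trans hWT) sdiff_subset)).trans hTd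
    have hinter : W ∩ (R ∪ T \ W) = R := by
      ext i
      have := @hRW i
      simp only [mem_inter, mem_union, mem_sdiff]
      tauto
    have h3 := abs_expect_mul_sub_le hμ hε hP huW
      ((junta_relES (μ := μ) R (T \ W) f).pow 2)
    rw [hinter] at h3
    have h4 : (k : ℝ) ^ 2 * ε * l2norm μ u * l2norm μ (relES μ R (T \ W) f ^ 2) ≤ e :=
      mul_le_mul_of_nonneg_left (l2norm_relES_sq_le hμ hf hδ hcard) (by positivity)
    linarith [le_of_abs_le h3]
  have h5 : ∀ R ∈ W.powerset,
      ∑ T ∈ 𝒯, expect μ (Aop μ R u * relES μ R (T \ W) f ^ 2) ≤ 2 * δ ^ 2 * expect μ u := by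
    intro R hR
    have hRW := mem_powerset.1 hR
    refine le_trans ?_ (sum_expect_Aop_mul_relES_sq_le hμ hε hP hf hδ hk
      ((card_le_card hRW).trans hW) hu)
    have hinj : Set.InjOn (fun T => T \ W) (𝒯 : Set (Finset (Fin k))) := by
      intro T hT T' hT' h
      rw [← union_sdiff_of_subset (hT𝒯 T hT).2, ← union_sdiff_of_subset (hT𝒯 T' hT').2]
      exact congrArg (W ∪ ·) h
    rw [← sum_image (f := fun Y => expect μ (Aop μ R u * relES μ R Y f ^ 2)) hinj]
    refine sum_le_sum_of_subset_of_nonneg ?_ fun Y _ _ => expect_nonneg hμ fun x =>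
      mul_nonneg (Aop_nonneg hμ hu x) (sq_nonneg _)
    intro Y hY
    obtain ⟨T, _, rfl⟩ := mem_image.1 hY
    rw [mem_powerset]
    intro i hi
    rw [mem_compl]
    exact fun H => (mem_sdiff.1 hi).2 (hRW H)
  calc ∑ T ∈ 𝒯, expect μ (u * ES μ T f ^ 2)
      ≤ ∑ T ∈ 𝒯, 2 ^ W.card * ∑ R ∈ W.powerset,
          (expect μ (Aop μ R u * relES μ R (T \ W) f ^ 2) + e) := sum_le_sum h1
    _ = 2 ^ W.card * ∑ R ∈ W.powerset,
          (∑ T ∈ 𝒯, expect μ (Aop μ R u * relES μ R (T \ W) f ^ 2) + 𝒯.card * e) := by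
        rw [← mul_sum, sum_comm]
        simp [sum_add_distrib]
    _ ≤ 2 ^ W.card * ∑ R ∈ W.powerset, (2 * δ ^ 2 * expect μ u + 2 ^ k * e) := by
        gcongr with R hR
        exact h5 R hR
    _ = 4 ^ W.card * (2 * δ ^ 2 * expect μ u) + 2 ^ W.card * 2 ^ W.card * 2 ^ k * e := by
        rw [sum_const, card_powerset, nsmul_eq_mul, show (4 : ℝ) = 2 * 2 by norm_num, mul_pow]
        push_cast
        ring
    _ ≤ 4 ^ d * (2 * δ ^ 2 * expect μ u) + 2 ^ k * 2 ^ k * 2 ^ k * e := by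
        gcongr
        · norm_num
        · norm_num
        · exact card_subset_le W
        · norm_num
        · exact card_subset_le W
    _ = _ := by
        rw [show (8 : ℝ) = 2 * 2 * 2 by norm_num, mul_pow, mul_pow]
        ring

/-- The energy in the link at `x ∈ V_W` of the components of degree at most `d` of `f`
involving all the coordinates in `W`. -/
noncomputable def energy (μ : (∀ i, V i) → ℝ) (d : ℕ) (f : (∀ i, V i) → ℝ)
    (W : Finset (Fin k)) : (∀ i, V i) → ℝ :=
  ∑ T ∈ (lowSets k d).filter (W ⊆ ·), Aop μ W (ES μ T f ^ 2)

lemma junta_energy : Junta W (energy μ d f W) :=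
  Junta.sum fun _ _ => junta_Aop _

lemma energy_nonneg (hμ : IsProb μ) (x : ∀ i, V i) : 0 ≤ energy μ d f W x := by
  rw [energy, Finset.sum_apply]
  exact sum_nonneg fun T _ => Aop_nonneg hμ (fun x => sq_nonneg (ES μ T f x)) x

lemma l2norm_ES_sq_le (hμ : IsProb μ) (hf : IsGlobal μ d δ f) (hδ : 0 ≤ δ)
    (hT : T.card ≤ d) : l2norm μ (ES μ T f ^ 2) ≤ 4 ^ k * δ * l2norm μ f := by
  rw [← relES_empty]
  exact l2norm_relES_sq_le hμ hf hδ (by rwa [empty_union])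

lemma l2norm_energy_le (hμ : IsProb μ) (hf : IsGlobal μ d δ f) (hδ : 0 ≤ δ) :
    l2norm μ (energy μ d f W) ≤ 2 ^ k * (4 ^ k * δ * l2norm μ f) := by
  have hf0 : 0 ≤ l2norm μ f := l2norm_nonneg
  refine (l2norm_sum_le_card hμ (a := 4 ^ k * δ * l2norm μ f) _ _ fun T hT => ?_).trans ?_
  · rw [mem_filter, mem_lowSets] at hT
    exact (l2norm_Aop_le hμ _).trans (l2norm_ES_sq_le hμ hf hδ hT.1)
  · gcongr
    exact (Nat.cast_le.2 (card_le_card (filter_subset _ _))).trans (card_lowSets_le k d)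

lemma expect_energy_sq_le (hμ : IsProb μ) (hε : 0 ≤ ε) (hP : EpsProduct μ ε)
    (hf : IsGlobal μ d δ f) (hδ : 0 ≤ δ) (hk : 16 ^ k * (k * ε) ≤ 1) (hW : W.card ≤ d) :
    expect μ (energy μ d f W ^ 2) ≤ 2 * 4 ^ d * δ ^ 2 * expect μ (energy μ d f W) +
      16 ^ k * ((k : ℝ) ^ 2 * ε * (4 ^ k * δ * l2norm μ f) ^ 2) := by
  have h1 := sum_expect_mul_ES_sq_le hμ hε hP hf hδ hk hW
    (energy_nonneg (μ := μ) (d := d) (f := f) (W := W) hμ) junta_energy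
  have h2 : expect μ (energy μ d f W ^ 2) =
      ∑ T ∈ (lowSets k d).filter (W ⊆ ·), expect μ (energy μ d f W * ES μ T f ^ 2) := by
    rw [sq]
    nth_rw 2 [energy]
    rw [mul_sum, expect_sum]
    exact sum_congr rfl fun T _ => expect_mul_Aop_of_junta hμ junta_energy _
  rw [h2]
  refine h1.trans (add_le_add_right ?_ _)
  have hf0 : 0 ≤ l2norm μ f := l2norm_nonneg
  calc _ ≤ 8 ^ k * ((k : ℝ) ^ 2 * ε * (2 ^ k * (4 ^ k * δ * l2norm μ f)) *
        (4 ^ k * δ * l2norm μ f)) := by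
        gcongr
        exact l2norm_energy_le hμ hf hδ
    _ = _ := by
        rw [show (16 : ℝ) = 8 * 2 by norm_num, mul_pow]
        ring

lemma sum_expect_ES_sq_le (hμ : IsProb μ) (hε : 0 ≤ ε) (hP : EpsProduct μ ε)
    (hk : 16 ^ k * (k * ε) ≤ 1) (f : (∀ i, V i) → ℝ) :
    ∑ T, expect μ (ES μ T f ^ 2) ≤ 2 * expect μ (f ^ 2) := by
  have h1 := sum_expect_relES_sq_le hμ hε hP ∅ f
  simp only [relES_empty, compl_empty, powerset_univ] at h1
  have : 0 ≤ expect μ (f ^ 2) := normSq_nonneg hμ f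
  nlinarith

lemma sum_expect_energy_le (hμ : IsProb μ) (hε : 0 ≤ ε) (hP : EpsProduct μ ε)
    (hk : 16 ^ k * (k * ε) ≤ 1) (f : (∀ i, V i) → ℝ) :
    ∑ W ∈ lowSets k d, expect μ (energy μ d f W) ≤ 2 * 2 ^ d * expect μ (f ^ 2) := by
  have hnn : ∀ T, 0 ≤ expect μ (ES μ T f ^ 2) := fun T => normSq_nonneg hμ _
  calc ∑ W ∈ lowSets k d, expect μ (energy μ d f W)
      = ∑ W ∈ lowSets k d, ∑ T ∈ lowSets k d,
          if W ⊆ T then expect μ (ES μ T f ^ 2) else 0 := by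
        refine sum_congr rfl fun W _ => ?_
        rw [energy, expect_sum, sum_filter]
        exact sum_congr rfl fun T _ => by rw [expect_Aop hμ]
    _ = ∑ T ∈ lowSets k d, ∑ W ∈ (lowSets k d).filter (· ⊆ T),
          expect μ (ES μ T f ^ 2) := by
        rw [sum_comm]
        exact sum_congr rfl fun T _ => (sum_filter _ _).symm
    _ ≤ ∑ T ∈ lowSets k d, 2 ^ d * expect μ (ES μ T f ^ 2) := by
        refine sum_le_sum fun T hT => ?_
        rw [sum_const, nsmul_eq_mul]
        refine mul_le_mul_of_nonneg_right ?_ (hnn T)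
        have h1 : ((lowSets k d).filter (· ⊆ T)).card ≤ 2 ^ d := by
          refine (card_le_card (t := T.powerset) fun W hW =>
            mem_powerset.2 (mem_filter.1 hW).2).trans ?_
          rw [card_powerset]
          exact Nat.pow_le_pow_right two_pos (mem_lowSets.1 hT)
        exact_mod_cast h1
    _ ≤ 2 ^ d * ∑ T, expect μ (ES μ T f ^ 2) := by
        rw [← mul_sum]
        exact mul_le_mul_of_nonneg_left (sum_le_sum_of_subset_of_nonneg (subset_univ _)
          fun T _ _ => hnn T) (by positivity)
    _ ≤ 2 ^ d * (2 * expect μ (f ^ 2)) := by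
        gcongr
        exact sum_expect_ES_sq_le hμ hε hP hk f
    _ = _ := by ring

lemma sum_expect_energy_sq_le (hμ : IsProb μ) (hε : 0 ≤ ε) (hP : EpsProduct μ ε)
    (hf : IsGlobal μ d δ f) (hδ : 0 ≤ δ) (hk : 16 ^ k * (k * ε) ≤ 1) :
    ∑ W ∈ lowSets k d, expect μ (energy μ d f W ^ 2) ≤
      4 * 8 ^ d * δ ^ 2 * expect μ (f ^ 2) +
        32 ^ k * ((k : ℝ) ^ 2 * ε * (4 ^ k * δ * l2norm μ f) ^ 2) := by
  set e := (k : ℝ) ^ 2 * ε * (4 ^ k * δ * l2norm μ f) ^ 2 with he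
  have he0 : 0 ≤ e := by positivity
  calc ∑ W ∈ lowSets k d, expect μ (energy μ d f W ^ 2)
      ≤ ∑ W ∈ lowSets k d,
          (2 * 4 ^ d * δ ^ 2 * expect μ (energy μ d f W) + 16 ^ k * e) :=
        sum_le_sum fun W hW => expect_energy_sq_le hμ hε hP hf hδ hk (mem_lowSets.1 hW)
    _ = 2 * 4 ^ d * δ ^ 2 * ∑ W ∈ lowSets k d, expect μ (energy μ d f W) +
          (lowSets k d).card * (16 ^ k * e) := by
        rw [sum_add_distrib, mul_sum, sum_const, nsmul_eq_mul]
    _ ≤ 2 * 4 ^ d * δ ^ 2 * (2 * 2 ^ d * expect μ (f ^ 2)) + 2 ^ k * (16 ^ k * e) := by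
        gcongr
        · exact sum_expect_energy_le hμ hε hP hk f
        · exact card_lowSets_le k d
    _ = _ := by
        rw [show (8 : ℝ) = 4 * 2 by norm_num, show (32 : ℝ) = 2 * 16 by norm_num, mul_pow,
          mul_pow]
        ring

end Energy

/-! ### The fourth moment of the low-degree part -/

section FourthMoment

variable {μ : (∀ i, V i) → ℝ} {ε δ : ℝ} {d : ℕ} {R T₁ T₂ T₃ T₄ : Finset (Fin k)}
  {f : (∀ i, V i) → ℝ} {i : Fin k}

lemma l2norm_ES_le (hμ : IsProb μ) (T : Finset (Fin k)) (f : (∀ i, V i) → ℝ) :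
    l2norm μ (ES μ T f) ≤ 2 ^ k * l2norm μ f := by
  rw [← relES_empty]
  exact l2norm_relES_le hμ ∅ T f

lemma abs_expect_ES_mul_le (hμ : IsProb μ) (hε : 0 ≤ ε) (hP : EpsProduct μ ε)
    (hf : IsGlobal μ d δ f) (hδ : 0 ≤ δ) (h₂ : T₂.card ≤ d) (h₃ : T₃.card ≤ d)
    (hi₁ : i ∈ T₁) (hi₂ : i ∉ T₂) (hi₃ : i ∉ T₃) (hi₄ : i ∉ T₄) :
    |expect μ (ES μ T₁ f * (ES μ T₂ f * (ES μ T₃ f * ES μ T₄ f)))| ≤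
      (k : ℝ) ^ 2 * ε * (4 ^ k * δ * l2norm μ f) ^ 2 := by
  have hf0 : 0 ≤ l2norm μ f := l2norm_nonneg
  have hu : Junta (T₂ ∪ (T₃ ∪ T₄)) (ES μ T₂ f * (ES μ T₃ f * ES μ T₄ f)) :=
    ((junta_ES T₂ f).mono subset_union_left).mul
      ((((junta_ES T₃ f).mono subset_union_left).mul
        ((junta_ES T₄ f).mono subset_union_right)).mono subset_union_right)
  have h1 := abs_expect_relES_mul_le hμ hε hP hi₁ (notMem_empty i) f hu
    (by simp [hi₂, hi₃, hi₄])
  rw [relES_empty] at h1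
  have h2 : l2norm μ (ES μ T₂ f * (ES μ T₃ f * ES μ T₄ f)) ≤
      2 ^ k * δ * (2 ^ k * δ * (2 ^ k * l2norm μ f)) :=
    (l2norm_mul_le hμ (abs_ES_le hμ hf hδ h₂)).trans (mul_le_mul_of_nonneg_left
      ((l2norm_mul_le hμ (abs_ES_le hμ hf hδ h₃)).trans
        (mul_le_mul_of_nonneg_left (l2norm_ES_le hμ T₄ f) (by positivity))) (by positivity))
  have hk1 : (k : ℝ) ≤ (k : ℝ) ^ 2 := by
    exact_mod_cast Nat.le_self_pow two_ne_zero k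
  calc _ ≤ 2 ^ k * (k * ε * l2norm μ f) * (2 ^ k * δ * (2 ^ k * δ * (2 ^ k * l2norm μ f))) :=
        h1.trans (mul_le_mul_of_nonneg_left h2 (by positivity))
    _ = k * (ε * (4 ^ k * δ * l2norm μ f) ^ 2) := by
        rw [show (4 : ℝ) ^ k = 2 ^ k * 2 ^ k by rw [← mul_pow]; norm_num]
        ring
    _ ≤ (k : ℝ) ^ 2 * (ε * (4 ^ k * δ * l2norm μ f) ^ 2) :=
        mul_le_mul_of_nonneg_right hk1 (by positivity)
    _ = _ := by ring

/-- The absolute value of an approximate Efron–Stein component. -/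
noncomputable def absES (μ : (∀ i, V i) → ℝ) (T : Finset (Fin k)) (f : (∀ i, V i) → ℝ)
    (x : ∀ i, V i) : ℝ := |ES μ T f x|

lemma absES_nonneg (T : Finset (Fin k)) (x : ∀ i, V i) : 0 ≤ absES μ T f x := abs_nonneg _

lemma absES_sq (T : Finset (Fin k)) : absES μ T f ^ 2 = ES μ T f ^ 2 :=
  funext fun x => sq_abs (ES μ T f x)

lemma junta_absES (T : Finset (Fin k)) : Junta T (absES μ T f) := (junta_ES T f).comp abs

lemma l2norm_absES_mul_le (hμ : IsProb μ) (hf : IsGlobal μ d δ f) (hδ : 0 ≤ δ)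
    (h₁ : T₁.card ≤ d) :
    l2norm μ (absES μ T₁ f * absES μ T₂ f) ≤ 4 ^ k * δ * l2norm μ f := by
  have h1 : l2norm μ (absES μ T₂ f) ≤ 2 ^ k * l2norm μ f :=
    (l2norm_mono hμ fun x => (abs_abs (ES μ T₂ f x)).le).trans (l2norm_ES_le hμ T₂ f)
  refine (l2norm_mul_le hμ (B := 2 ^ k * δ) fun x => ?_).trans
    ((mul_le_mul_of_nonneg_left h1 (by positivity)).trans_eq ?_)
  · exact (abs_abs (ES μ T₁ f x)).trans_le (abs_ES_le hμ hf hδ h₁ x)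
  · rw [show (4 : ℝ) = 2 * 2 by norm_num, mul_pow]
    ring

/-- The pairs of sets of size at most `d` which agree outside `R` and whose union covers
`R`. -/
def coverPairs (d : ℕ) (R : Finset (Fin k)) : Finset (Finset (Fin k) × Finset (Fin k)) :=
  (lowSets k d ×ˢ lowSets k d).filter fun p => symmDiff p.1 p.2 ⊆ R ∧ R ⊆ p.1 ∪ p.2

lemma mem_coverPairs {p : Finset (Fin k) × Finset (Fin k)} :
    p ∈ coverPairs d R ↔
      (p.1.card ≤ d ∧ p.2.card ≤ d) ∧ symmDiff p.1 p.2 ⊆ R ∧ R ⊆ p.1 ∪ p.2 := by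
  simp [coverPairs, mem_lowSets]

lemma exists_mem_exactly_one {α : Type*} [DecidableEq α] {A B C D : Finset α}
    (h : ¬(symmDiff A B ⊆ (A ∪ B) ∩ (C ∪ D) ∧ symmDiff C D ⊆ (A ∪ B) ∩ (C ∪ D))) :
    ∃ i, (i ∈ A ∧ i ∉ B ∧ i ∉ C ∧ i ∉ D) ∨ (i ∈ B ∧ i ∉ A ∧ i ∉ C ∧ i ∉ D) ∨
      (i ∈ C ∧ i ∉ D ∧ i ∉ A ∧ i ∉ B) ∨ (i ∈ D ∧ i ∉ C ∧ i ∉ A ∧ i ∉ B) := by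
  rw [not_and_or, not_subset, not_subset] at h
  obtain ⟨i, hi, hi'⟩ | ⟨i, hi, hi'⟩ := h <;>
  · rw [mem_symmDiff] at hi
    rw [mem_inter, mem_union, mem_union] at hi'
    exact ⟨i, by tauto⟩

/-- A product of four components has negligible expectation unless no coordinate occurs
in exactly one of them. -/
lemma expect_ES_mul_le (hμ : IsProb μ) (hε : 0 ≤ ε) (hP : EpsProduct μ ε)
    (hf : IsGlobal μ d δ f) (hδ : 0 ≤ δ) {p q : Finset (Fin k) × Finset (Fin k)}
    (hp : p ∈ lowSets k d ×ˢ lowSets k d) (hq : q ∈ lowSets k d ×ˢ lowSets k d) :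
    expect μ (ES μ p.1 f * ES μ p.2 f * (ES μ q.1 f * ES μ q.2 f)) ≤
      (∑ R, if p ∈ coverPairs d R ∧ q ∈ coverPairs d R then
        expect μ (Aop μ R (absES μ p.1 f * absES μ p.2 f) *
          Aop μ R (absES μ q.1 f * absES μ q.2 f)) else 0) +
        (k : ℝ) ^ 2 * ε * (4 ^ k * δ * l2norm μ f) ^ 2 := by
  have hf0 : 0 ≤ l2norm μ f := l2norm_nonneg
  rw [mem_product, mem_lowSets, mem_lowSets] at hp hq
  set F : Finset (Fin k) → ℝ := fun R =>
    if p ∈ coverPairs d R ∧ q ∈ coverPairs d R then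
      expect μ (Aop μ R (absES μ p.1 f * absES μ p.2 f) *
        Aop μ R (absES μ q.1 f * absES μ q.2 f)) else 0 with hF
  have habs : ∀ (a b : Finset (Fin k)) x, 0 ≤ (absES μ a f * absES μ b f) x := fun a b x =>
    mul_nonneg (absES_nonneg a x) (absES_nonneg b x)
  have hF0 : ∀ R, 0 ≤ F R := by
    intro R
    simp only [hF]
    split_ifs
    · exact expect_nonneg hμ fun x =>
        mul_nonneg (Aop_nonneg hμ (habs _ _) x) (Aop_nonneg hμ (habs _ _) x)
    · exact le_rfl
  by_cases hgood : symmDiff p.1 p.2 ⊆ (p.1 ∪ p.2) ∩ (q.1 ∪ q.2) ∧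
      symmDiff q.1 q.2 ⊆ (p.1 ∪ p.2) ∩ (q.1 ∪ q.2)
  · have h1 : F ((p.1 ∪ p.2) ∩ (q.1 ∪ q.2)) ≤ ∑ R, F R :=
      single_le_sum (fun R _ => hF0 R) (mem_univ _)
    have h2 := expect_mul_le_expect_Aop hμ hε hP
      (((junta_absES (μ := μ) (f := f) p.1).mono (subset_union_left (s₂ := p.2))).mul
        ((junta_absES (μ := μ) (f := f) p.2).mono subset_union_right))
      (((junta_absES (μ := μ) (f := f) q.1).mono (subset_union_left (s₂ := q.2))).mul
        ((junta_absES (μ := μ) (f := f) q.2).mono subset_union_right))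
    simp only [hF] at h1
    rw [if_pos ⟨mem_coverPairs.2 ⟨hp, hgood.1, inter_subset_left⟩,
      mem_coverPairs.2 ⟨hq, hgood.2, inter_subset_right⟩⟩] at h1
    have h3 : expect μ (ES μ p.1 f * ES μ p.2 f * (ES μ q.1 f * ES μ q.2 f)) ≤
        expect μ (absES μ p.1 f * absES μ p.2 f * (absES μ q.1 f * absES μ q.2 f)) :=
      expect_mono hμ fun x _ => by
        simp only [Pi.mul_apply, absES, ← abs_mul]
        exact le_abs_self _
    have h4 : (k : ℝ) ^ 2 * ε * l2norm μ (absES μ p.1 f * absES μ p.2 f) *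
        l2norm μ (absES μ q.1 f * absES μ q.2 f) ≤
          (k : ℝ) ^ 2 * ε * (4 ^ k * δ * l2norm μ f) ^ 2 := by
      rw [sq (4 ^ k * δ * l2norm μ f), ← mul_assoc]
      gcongr
      · exact l2norm_nonneg
      · exact l2norm_absES_mul_le hμ hf hδ hp.1
      · exact l2norm_absES_mul_le hμ hf hδ hq.1
    linarith
  · refine le_trans ?_ (le_add_of_nonneg_left (sum_nonneg fun R _ => hF0 R))
    have key : ∀ T₁ T₂ T₃ T₄ : Finset (Fin k), T₂.card ≤ d → T₃.card ≤ d →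
        (∃ i, i ∈ T₁ ∧ i ∉ T₂ ∧ i ∉ T₃ ∧ i ∉ T₄) →
        ES μ p.1 f * ES μ p.2 f * (ES μ q.1 f * ES μ q.2 f) =
          ES μ T₁ f * (ES μ T₂ f * (ES μ T₃ f * ES μ T₄ f)) →
        expect μ (ES μ p.1 f * ES μ p.2 f * (ES μ q.1 f * ES μ q.2 f)) ≤
          (k : ℝ) ^ 2 * ε * (4 ^ k * δ * l2norm μ f) ^ 2 := by
      rintro T₁ T₂ T₃ T₄ h₂ h₃ ⟨i, hi₁, hi₂, hi₃, hi₄⟩ h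
      rw [h]
      exact le_of_abs_le (abs_expect_ES_mul_le hμ hε hP hf hδ h₂ h₃ hi₁ hi₂ hi₃ hi₄)
    obtain ⟨i, hi | hi | hi | hi⟩ :=
      exists_mem_exactly_one hgood
    · exact key p.1 p.2 q.1 q.2 hp.2 hq.1 ⟨i, hi⟩ (by ring)
    · exact key p.2 p.1 q.1 q.2 hp.1 hq.1 ⟨i, hi⟩ (by ring)
    · exact key q.1 q.2 p.1 p.2 hq.2 hp.1 ⟨i, hi⟩ (by ring)
    · exact key q.2 q.1 p.1 p.2 hq.1 hp.1 ⟨i, hi⟩ (by ring)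

lemma expect_sum_ES_pow_four_le (hμ : IsProb μ) (hε : 0 ≤ ε) (hP : EpsProduct μ ε)
    (hf : IsGlobal μ d δ f) (hδ : 0 ≤ δ) :
    expect μ ((∑ T ∈ lowSets k d, ES μ T f) ^ 4) ≤
      ∑ R, expect μ ((∑ p ∈ coverPairs d R,
        Aop μ R (absES μ p.1 f * absES μ p.2 f)) ^ 2) +
      16 ^ k * ((k : ℝ) ^ 2 * ε * (4 ^ k * δ * l2norm μ f) ^ 2) := by
  set e := (k : ℝ) ^ 2 * ε * (4 ^ k * δ * l2norm μ f) ^ 2 with he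
  have he0 : 0 ≤ e := by positivity
  set L := lowSets k d ×ˢ lowSets k d with hL
  have hLc : (L.card : ℝ) ≤ 2 ^ k * 2 ^ k := by
    rw [hL, card_product]
    push_cast
    exact mul_le_mul (card_lowSets_le k d) (card_lowSets_le k d) (by positivity)
      (by positivity)
  have h1 : expect μ ((∑ T ∈ lowSets k d, ES μ T f) ^ 4) =
      ∑ p ∈ L, ∑ q ∈ L, expect μ (ES μ p.1 f * ES μ p.2 f * (ES μ q.1 f * ES μ q.2 f)) := by
    have : (∑ T ∈ lowSets k d, ES μ T f) ^ 4 =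
        ∑ p ∈ L, ∑ q ∈ L, ES μ p.1 f * ES μ p.2 f * (ES μ q.1 f * ES μ q.2 f) := by
      rw [← sum_mul_sum, hL, sum_product, ← sum_mul_sum (lowSets k d) (lowSets k d)
        (fun T => ES μ T f) fun T => ES μ T f]
      ring
    rw [this, expect_sum]
    exact sum_congr rfl fun p _ => expect_sum _ _
  have h2 : ∀ R, expect μ ((∑ p ∈ coverPairs d R,
        Aop μ R (absES μ p.1 f * absES μ p.2 f)) ^ 2) =
      ∑ p ∈ L, ∑ q ∈ L, if p ∈ coverPairs d R ∧ q ∈ coverPairs d R then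
        expect μ (Aop μ R (absES μ p.1 f * absES μ p.2 f) *
          Aop μ R (absES μ q.1 f * absES μ q.2 f)) else 0 := by
    intro R
    have hsub : coverPairs d R = L.filter (· ∈ coverPairs d R) := by
      rw [filter_mem_eq_inter]
      exact (inter_eq_right.2 (filter_subset _ _)).symm
    rw [sq, sum_mul_sum, expect_sum, hsub, sum_filter]
    refine sum_congr rfl fun p _ => ?_
    rw [← hsub]
    split_ifs with hp
    · rw [hsub, expect_sum, sum_filter, ← hsub]
      simp only [hp, true_and]
    · simp [hp]
  rw [h1]
  calc _ ≤ ∑ p ∈ L, ∑ q ∈ L, ((∑ R, if p ∈ coverPairs d R ∧ q ∈ coverPairs d R then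
        expect μ (Aop μ R (absES μ p.1 f * absES μ p.2 f) *
          Aop μ R (absES μ q.1 f * absES μ q.2 f)) else 0) + e) :=
        sum_le_sum fun p hp => sum_le_sum fun q hq => expect_ES_mul_le hμ hε hP hf hδ hp hq
    _ = ∑ R, expect μ ((∑ p ∈ coverPairs d R,
          Aop μ R (absES μ p.1 f * absES μ p.2 f)) ^ 2) + L.card * L.card * e := by
        simp only [h2, sum_add_distrib, sum_const, nsmul_eq_mul]
        rw [sum_comm, ← mul_assoc]
        congr 1
        rw [sum_comm]
        rw [sum_comm (s := univ)]
        exact sum_congr rfl fun p _ => sum_comm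
    _ ≤ _ := by
        rw [show (16 : ℝ) = 2 * 2 * (2 * 2) by norm_num, mul_pow, mul_pow]
        gcongr

/-- The pairs of sets of size at most `d` whose union covers `R`. -/
def covers (d : ℕ) (R : Finset (Fin k)) : Finset (Finset (Fin k) × Finset (Fin k)) :=
  (lowSets k d ×ˢ lowSets k d).filter fun t => R ⊆ t.1 ∪ t.2

lemma sum_coverPairs_fiber_sq_le (hμ : IsProb μ) (h : Finset (Fin k) → (∀ i, V i) → ℝ)
    (c : Finset (Fin k) × Finset (Fin k)) (x : ∀ i, V i) :
    (∑ p ∈ (coverPairs d R).filter (fun p => (p.1 ∩ R, p.2 ∩ R) = c),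
        Aop μ R (h p.1 * h p.2) x) ^ 2 ≤
      ∑ t ∈ covers d R, Aop μ R (h t.1 ^ 2) x * Aop μ R (h t.2 ^ 2) x := by
  set F := (coverPairs d R).filter (fun p => (p.1 ∩ R, p.2 ∩ R) = c) with hF
  have hFm : ∀ p ∈ F, ((p.1.card ≤ d ∧ p.2.card ≤ d) ∧
      (∀ i, i ∉ R → (i ∈ p.1 ↔ i ∈ p.2)) ∧ ∀ i ∈ R, i ∈ p.1 ∨ i ∈ p.2) ∧
      ∀ i ∈ R, (i ∈ p.1 ↔ i ∈ c.1) ∧ (i ∈ p.2 ↔ i ∈ c.2) := by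
    intro p hp
    rw [hF, mem_filter, mem_coverPairs] at hp
    obtain ⟨⟨hd, h1, h2⟩, rfl⟩ := hp
    refine ⟨⟨hd, fun i hi => ?_, fun i hi => mem_union.1 (h2 hi)⟩, fun i hi => ?_⟩
    · have := @h1 i
      rw [mem_symmDiff] at this
      tauto
    · simp [hi]
  refine (sum_Aop_mul_sq_le hμ F (fun p => h p.1) (fun p => h p.2) x).trans ?_
  have hinj : Set.InjOn (fun pq : (Finset (Fin k) × Finset (Fin k)) ×
      (Finset (Fin k) × Finset (Fin k)) => (pq.1.1, pq.2.2)) (F ×ˢ F : Finset _) := by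
    rintro ⟨⟨a₁, a₂⟩, ⟨b₁, b₂⟩⟩ hab ⟨⟨a₁', a₂'⟩, ⟨b₁', b₂'⟩⟩ hab' heq
    rw [mem_coe, mem_product] at hab hab'
    simp only [Prod.mk.injEq] at heq
    obtain ⟨rfl, rfl⟩ := heq
    have ha := hFm _ hab.1
    have hb := hFm _ hab.2
    have ha' := hFm _ hab'.1
    have hb' := hFm _ hab'.2
    have e1 : a₂ = a₂' := by
      ext i
      by_cases hi : i ∈ R
      · exact (ha.2 i hi).2.trans (ha'.2 i hi).2.symm
      · exact (ha.1.2.1 i hi).symm.trans (ha'.1.2.1 i hi)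
    have e2 : b₁ = b₁' := by
      ext i
      by_cases hi : i ∈ R
      · exact (hb.2 i hi).1.trans (hb'.2 i hi).1.symm
      · exact (hb.1.2.1 i hi).trans (hb'.1.2.1 i hi).symm
    rw [e1, e2]
  rw [sum_mul_sum, ← sum_product',
    ← sum_image (f := fun t => Aop μ R (h t.1 ^ 2) x * Aop μ R (h t.2 ^ 2) x) hinj]
  refine sum_le_sum_of_subset_of_nonneg ?_ fun t _ _ =>
    mul_nonneg (Aop_nonneg hμ (fun x => sq_nonneg (h t.1 x)) x)
      (Aop_nonneg hμ (fun x => sq_nonneg (h t.2 x)) x)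
  intro t ht
  obtain ⟨⟨p, q⟩, hpq, rfl⟩ := mem_image.1 ht
  rw [mem_product] at hpq
  have hp := hFm p hpq.1
  have hq := hFm q hpq.2
  simp only [covers, mem_filter, mem_product, mem_lowSets]
  refine ⟨⟨hp.1.1.1, hq.1.1.2⟩, fun i hi => mem_union.2 ?_⟩
  rcases hp.1.2.2 i hi with h1 | h1
  · exact Or.inl h1
  · exact Or.inr ((hq.2 i hi).2.2 ((hp.2 i hi).2.1 h1))

lemma sum_coverPairs_sq_le (hμ : IsProb μ) (h : Finset (Fin k) → (∀ i, V i) → ℝ)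
    (x : ∀ i, V i) :
    (∑ p ∈ coverPairs d R, Aop μ R (h p.1 * h p.2) x) ^ 2 ≤
      256 ^ d * ∑ t ∈ covers d R, Aop μ R (h t.1 ^ 2) x * Aop μ R (h t.2 ^ 2) x := by
  have hN : 0 ≤ ∑ t ∈ covers d R, Aop μ R (h t.1 ^ 2) x * Aop μ R (h t.2 ^ 2) x :=
    sum_nonneg fun t _ => mul_nonneg (Aop_nonneg hμ (fun x => sq_nonneg (h t.1 x)) x)
      (Aop_nonneg hμ (fun x => sq_nonneg (h t.2 x)) x)
  rcases (coverPairs d R).eq_empty_or_nonempty with hE | ⟨p, hp⟩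
  · rw [hE]
    simp only [sum_empty, ne_eq, OfNat.ofNat_ne_zero, not_false_eq_true, zero_pow]
    positivity
  rw [mem_coverPairs] at hp
  have hR : R.card ≤ 2 * d := by
    have := (card_le_card hp.2.2).trans (card_union_le _ _)
    omega
  set K := R.powerset ×ˢ R.powerset with hK
  have hKc : (K.card : ℝ) ≤ 16 ^ d := by
    rw [hK, card_product, card_powerset]
    have : (2 : ℝ) ^ R.card ≤ 2 ^ (2 * d) := pow_le_pow_right₀ one_le_two hR
    push_cast
    calc (2 : ℝ) ^ R.card * 2 ^ R.card ≤ 2 ^ (2 * d) * 2 ^ (2 * d) := by gcongr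
      _ = 16 ^ d := by
        rw [← mul_pow, pow_mul]
        norm_num
  have hmaps : ∀ p ∈ coverPairs d R, (p.1 ∩ R, p.2 ∩ R) ∈ K := fun p _ => by
    simp [hK]
  rw [← sum_fiberwise_of_maps_to hmaps]
  calc _ ≤ K.card * ∑ c ∈ K, (∑ p ∈ (coverPairs d R).filter
          (fun p => (p.1 ∩ R, p.2 ∩ R) = c), Aop μ R (h p.1 * h p.2) x) ^ 2 :=
        sq_sum_le_card_mul_sum_sq
    _ ≤ K.card * (K.card *
          ∑ t ∈ covers d R, Aop μ R (h t.1 ^ 2) x * Aop μ R (h t.2 ^ 2) x) := by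
        refine mul_le_mul_of_nonneg_left ?_ (by positivity)
        rw [← nsmul_eq_mul]
        exact sum_le_card_nsmul _ _ _ fun c _ => sum_coverPairs_fiber_sq_le hμ h c x
    _ ≤ 16 ^ d * (16 ^ d *
          ∑ t ∈ covers d R, Aop μ R (h t.1 ^ 2) x * Aop μ R (h t.2 ^ 2) x) := by
        gcongr
    _ = _ := by
        rw [show (256 : ℝ) = 16 * 16 by norm_num, mul_pow, mul_assoc]

lemma sum_expect_covers_le (hμ : IsProb μ) (hε : 0 ≤ ε) (hP : EpsProduct μ ε)
    (hf : IsGlobal μ d δ f) (hδ : 0 ≤ δ) :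
    ∑ R, ∑ t ∈ covers d R, expect μ (Aop μ R (ES μ t.1 f ^ 2) * Aop μ R (ES μ t.2 f ^ 2)) ≤
      4 ^ d * ∑ W ∈ lowSets k d, expect μ (energy μ d f W ^ 2) +
        8 ^ k * (3 * ((k : ℝ) ^ 2 * ε * (4 ^ k * δ * l2norm μ f) ^ 2)) := by
  have hf0 : 0 ≤ l2norm μ f := l2norm_nonneg
  set e := (k : ℝ) ^ 2 * ε * (4 ^ k * δ * l2norm μ f) ^ 2 with he
  have he0 : 0 ≤ e := by positivity
  set L := lowSets k d ×ˢ lowSets k d with hL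
  have hLc : (L.card : ℝ) ≤ 2 ^ k * 2 ^ k := by
    rw [hL, card_product]
    push_cast
    exact mul_le_mul (card_lowSets_le k d) (card_lowSets_le k d) (by positivity)
      (by positivity)
  set G : Finset (Fin k) × Finset (Fin k) → Finset (Fin k) → ℝ := fun t W =>
    expect μ (Aop μ W (ES μ t.1 f ^ 2) * Aop μ W (ES μ t.2 f ^ 2)) with hG
  have hG0 : ∀ t W, 0 ≤ G t W := fun t W => expect_nonneg hμ fun x =>
    mul_nonneg (Aop_nonneg hμ (fun x => sq_nonneg (ES μ t.1 f x)) x)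
      (Aop_nonneg hμ (fun x => sq_nonneg (ES μ t.2 f x)) x)
  have h1 : ∀ t ∈ L, ∀ R, G t R ≤ G t (t.1 ∩ t.2 ∩ R) + 3 * e := by
    intro t ht R
    rw [hL, mem_product, mem_lowSets, mem_lowSets] at ht
    refine (expect_Aop_mul_Aop_le hμ hε hP ((junta_ES (μ := μ) t.1 f).pow 2)
      ((junta_ES (μ := μ) t.2 f).pow 2) R).trans ?_
    have : (k : ℝ) ^ 2 * ε * l2norm μ (ES μ t.1 f ^ 2) * l2norm μ (ES μ t.2 f ^ 2) ≤ e := by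
      rw [he, sq (4 ^ k * δ * l2norm μ f), ← mul_assoc]
      gcongr
      · exact l2norm_nonneg
      · exact l2norm_ES_sq_le hμ hf hδ ht.1
      · exact l2norm_ES_sq_le hμ hf hδ ht.2
    linarith
  have h2 : ∀ t ∈ L, ∑ R, (if R ⊆ t.1 ∪ t.2 then G t R else 0) ≤
      4 ^ d * (∑ W ∈ (t.1 ∩ t.2).powerset, G t W) + 2 ^ k * (3 * e) := by
    intro t ht
    have ht' := ht
    rw [hL, mem_product, mem_lowSets, mem_lowSets] at ht'
    have hc1 : ((t.1 ∪ t.2).powerset.card : ℝ) ≤ 4 ^ d := by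
      rw [card_powerset]
      have : (t.1 ∪ t.2).card ≤ 2 * d := by
        have := card_union_le t.1 t.2
        omega
      calc ((2 ^ (t.1 ∪ t.2).card : ℕ) : ℝ) = 2 ^ (t.1 ∪ t.2).card := by push_cast; rfl
        _ ≤ 2 ^ (2 * d) := pow_le_pow_right₀ one_le_two this
        _ = 4 ^ d := by rw [pow_mul]; norm_num
    have hc2 : ((t.1 ∪ t.2).powerset.card : ℝ) ≤ 2 ^ k := by
      rw [card_powerset]
      push_cast
      exact two_pow_card_le _
    have hS : 0 ≤ ∑ W ∈ (t.1 ∩ t.2).powerset, G t W := sum_nonneg fun W _ => hG0 t W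
    calc ∑ R, (if R ⊆ t.1 ∪ t.2 then G t R else 0)
        = ∑ R ∈ (t.1 ∪ t.2).powerset, G t R := by
          rw [← sum_filter]
          refine sum_congr ?_ fun _ _ => rfl
          ext R
          rw [mem_filter, mem_powerset]
          exact and_iff_right (mem_univ R)
      _ ≤ ∑ R ∈ (t.1 ∪ t.2).powerset, (∑ W ∈ (t.1 ∩ t.2).powerset, G t W + 3 * e) := by
          refine sum_le_sum fun R _ => (h1 t ht R).trans (add_le_add_left ?_ _)
          exact single_le_sum (f := G t) (fun W _ => hG0 t W)
            (mem_powerset.2 inter_subset_left)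
      _ = (t.1 ∪ t.2).powerset.card * (∑ W ∈ (t.1 ∩ t.2).powerset, G t W) +
            (t.1 ∪ t.2).powerset.card * (3 * e) := by
          rw [sum_const, nsmul_eq_mul, mul_add]
      _ ≤ _ := by gcongr
  have h3 : ∑ t ∈ L, ∑ W ∈ (t.1 ∩ t.2).powerset, G t W =
      ∑ W ∈ lowSets k d, expect μ (energy μ d f W ^ 2) := by
    have h4 : ∀ W, expect μ (energy μ d f W ^ 2) =
        ∑ t ∈ L, if W ⊆ t.1 ∩ t.2 then G t W else 0 := by
      intro W
      rw [energy, sq, sum_mul_sum, ← sum_product', expect_sum, ← sum_filter]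
      refine sum_congr ?_ fun _ _ => rfl
      ext t
      simp only [hL, mem_product, mem_filter, subset_inter_iff]
      tauto
    simp only [h4]
    rw [sum_comm]
    refine sum_congr rfl fun t ht => ?_
    rw [← sum_filter]
    refine sum_congr ?_ fun _ _ => rfl
    ext W
    rw [hL, mem_product, mem_lowSets, mem_lowSets] at ht
    simp only [mem_powerset, mem_filter, mem_lowSets]
    exact ⟨fun hW => ⟨(card_le_card (hW.trans inter_subset_left)).trans ht.1, hW⟩,
      fun hW => hW.2⟩
  calc _ = ∑ t ∈ L, ∑ R, (if R ⊆ t.1 ∪ t.2 then G t R else 0) := by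
        rw [sum_comm]
        exact sum_congr rfl fun R _ => sum_filter _ _
    _ ≤ ∑ t ∈ L, (4 ^ d * (∑ W ∈ (t.1 ∩ t.2).powerset, G t W) + 2 ^ k * (3 * e)) :=
        sum_le_sum h2
    _ = 4 ^ d * ∑ W ∈ lowSets k d, expect μ (energy μ d f W ^ 2) +
          L.card * (2 ^ k * (3 * e)) := by
        rw [sum_add_distrib, ← mul_sum, h3, sum_const, nsmul_eq_mul]
    _ ≤ 4 ^ d * ∑ W ∈ lowSets k d, expect μ (energy μ d f W ^ 2) +
          2 ^ k * 2 ^ k * (2 ^ k * (3 * e)) := by gcongr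
    _ = _ := by
        rw [show (8 : ℝ) = 2 * 2 * 2 by norm_num, mul_pow, mul_pow]
        ring

/-- Hypercontractivity for global functions. -/
theorem expect_sum_ES_pow_four_le_of_isGlobal (hμ : IsProb μ) (hε : 0 ≤ ε)
    (hP : EpsProduct μ ε) (hf : IsGlobal μ d δ f) (hδ : 0 ≤ δ) (hd : d ≤ k)
    (hk : 16 ^ k * (k * ε) ≤ 1) (hk' : 5 * 32768 ^ k * (16 ^ k * (k ^ 2 * ε)) ≤ 1) :
    expect μ ((∑ T ∈ lowSets k d, ES μ T f) ^ 4) ≤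
      5 * 8192 ^ d * δ ^ 2 * expect μ (f ^ 2) := by
  set e := (k : ℝ) ^ 2 * ε * (4 ^ k * δ * l2norm μ f) ^ 2 with he
  have he0 : 0 ≤ e := by positivity
  have hE : 0 ≤ expect μ (f ^ 2) := normSq_nonneg hμ f
  have h1 : ∀ R, expect μ ((∑ p ∈ coverPairs d R,
        Aop μ R (absES μ p.1 f * absES μ p.2 f)) ^ 2) ≤
      256 ^ d * ∑ t ∈ covers d R,
        expect μ (Aop μ R (ES μ t.1 f ^ 2) * Aop μ R (ES μ t.2 f ^ 2)) := by
    intro R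
    rw [← expect_sum, ← expect_smul]
    refine expect_mono hμ fun x _ => ?_
    have := sum_coverPairs_sq_le (d := d) (R := R) hμ (fun T => absES μ T f) x
    simpa only [Pi.pow_apply, Finset.sum_apply, Pi.smul_apply, smul_eq_mul, Pi.mul_apply,
      absES_sq] using this
  have h2 := sum_expect_covers_le hμ hε hP hf hδ
  have h3 := sum_expect_energy_sq_le hμ hε hP hf hδ hk
  have h4 := expect_sum_ES_pow_four_le hμ hε hP hf hδ
  rw [← he] at h2 h3 h4
  have h5 : 5 * 32768 ^ k * e ≤ δ ^ 2 * expect μ (f ^ 2) := by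
    have : e = 16 ^ k * (k ^ 2 * ε) * (δ ^ 2 * expect μ (f ^ 2)) := by
      rw [he, mul_pow, mul_pow, l2norm_sq hμ, ← pow_mul, mul_comm k 2, pow_mul]
      norm_num
      ring
    rw [this, ← mul_assoc]
    exact mul_le_of_le_one_left (by positivity) hk'
  have hpow : ∀ a : ℝ, 1 ≤ a → a ^ d ≤ a ^ k := fun a ha => pow_le_pow_right₀ ha hd
  calc _ ≤ 256 ^ d * ∑ R, ∑ t ∈ covers d R,
          expect μ (Aop μ R (ES μ t.1 f ^ 2) * Aop μ R (ES μ t.2 f ^ 2)) + 16 ^ k * e := by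
        rw [mul_sum]
        exact h4.trans (add_le_add_left (sum_le_sum fun R _ => h1 R) _)
    _ ≤ 256 ^ d * (4 ^ d * (4 * 8 ^ d * δ ^ 2 * expect μ (f ^ 2) + 32 ^ k * e) +
          8 ^ k * (3 * e)) + 16 ^ k * e := by
        gcongr
        exact h2.trans (by gcongr)
    _ = 4 * (256 * 4 * 8 : ℝ) ^ d * δ ^ 2 * expect μ (f ^ 2) +
          256 ^ d * 4 ^ d * 32 ^ k * e + 3 * (256 ^ d * 8 ^ k * e) + 16 ^ k * e := by
        rw [mul_pow, mul_pow]
        ring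
    _ ≤ 4 * (256 * 4 * 8 : ℝ) ^ d * δ ^ 2 * expect μ (f ^ 2) +
          256 ^ k * 4 ^ k * 32 ^ k * e + 3 * (256 ^ k * 128 ^ k * e) + 32768 ^ k * e := by
        have a1 := hpow 256 (by norm_num)
        have a2 := hpow 4 (by norm_num)
        gcongr <;> norm_num
    _ = 4 * 8192 ^ d * δ ^ 2 * expect μ (f ^ 2) + 5 * 32768 ^ k * e := by
        rw [← mul_pow, ← mul_pow, ← mul_pow]
        norm_num
        ring
    _ ≤ 4 * 8192 ^ d * δ ^ 2 * expect μ (f ^ 2) + 8192 ^ d * (δ ^ 2 * expect μ (f ^ 2)) := by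
        have : (1 : ℝ) ≤ 8192 ^ d := one_le_pow₀ (by norm_num)
        have h6 : δ ^ 2 * expect μ (f ^ 2) ≤ 8192 ^ d * (δ ^ 2 * expect μ (f ^ 2)) :=
          le_mul_of_one_le_left (by positivity) this
        linarith
    _ = _ := by ring

end FourthMoment

/-! ### Small set expansion -/

section SmallSet

variable {μ : (∀ i, V i) → ℝ} {ε δ ρ : ℝ} {d : ℕ} {f : (∀ i, V i) → ℝ}

lemma five_mul_pow_le (hd : 1 ≤ d) : (5 : ℝ) * 8192 ^ d ≤ ((200 * (d : ℝ)) ^ d) ^ 4 := by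
  have hd' : (1 : ℝ) ≤ d := by exact_mod_cast hd
  calc (5 : ℝ) * 8192 ^ d ≤ 5 ^ d * 8192 ^ d := by
        gcongr
        exact le_self_pow₀ (by norm_num) (by omega)
    _ = 40960 ^ d := by
        rw [← mul_pow]
        norm_num
    _ ≤ ((200 * (d : ℝ)) ^ 4) ^ d := by
        gcongr
        have : (200 : ℝ) ^ 4 ≤ (200 * (d : ℝ)) ^ 4 :=
          pow_le_pow_left₀ (by norm_num) (by linarith) 4
        linarith
    _ = _ := by rw [← pow_mul, ← pow_mul, mul_comm 4 d]

/-- A global indicator function has small correlation with its low-degree part. -/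
lemma expect_mul_sum_ES_le (hμ : IsProb μ) (hε : 0 ≤ ε) (hP : EpsProduct μ ε)
    (hf : IsGlobal μ d δ f) (hδ : 0 ≤ δ) (hf01 : ∀ x, f x = 0 ∨ f x = 1) (hd1 : 1 ≤ d)
    (hd : d ≤ k) (hk : 16 ^ k * (k * ε) ≤ 1)
    (hk' : 5 * 32768 ^ k * (16 ^ k * (k ^ 2 * ε)) ≤ 1) :
    expect μ (f * ∑ T ∈ lowSets k d, ES μ T f) ≤
      (200 * (d : ℝ)) ^ d * Real.sqrt δ * expect μ (f ^ 2) := by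
  set g := ∑ T ∈ lowSets k d, ES μ T f with hg
  set m := expect μ (f ^ 2) with hm
  have hm0 : 0 ≤ m := normSq_nonneg hμ f
  have hff : f ^ 2 = f := funext fun x => by
    rcases hf01 x with h | h <;> simp [h]
  have h1 : expect μ (f * g) ^ 2 ≤ m * expect μ (f * g ^ 2) := by
    have := expect_mul_sq_le hμ f (f * g)
    rwa [← mul_assoc, ← sq, hff, mul_pow, hff, ← hff, ← hm, hff] at this
  have h2 : expect μ (f * g ^ 2) ^ 2 ≤ m * (5 * 8192 ^ d * δ ^ 2 * m) := by
    refine (expect_mul_sq_le hμ f (g ^ 2)).trans (mul_le_mul_of_nonneg_left ?_ hm0)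
    rw [← pow_mul]
    exact expect_sum_ES_pow_four_le_of_isGlobal hμ hε hP hf hδ hd hk hk'
  have h3 : expect μ (f * g) ^ 4 ≤ ((200 * (d : ℝ)) ^ d * Real.sqrt δ * m) ^ 4 := by
    have hs : Real.sqrt δ ^ 4 = δ ^ 2 := by
      rw [show 4 = 2 * 2 from rfl, pow_mul, Real.sq_sqrt hδ]
    calc expect μ (f * g) ^ 4 = (expect μ (f * g) ^ 2) ^ 2 := by ring
      _ ≤ (m * expect μ (f * g ^ 2)) ^ 2 := pow_le_pow_left₀ (sq_nonneg _) h1 2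
      _ = m ^ 2 * expect μ (f * g ^ 2) ^ 2 := by ring
      _ ≤ m ^ 2 * (m * (5 * 8192 ^ d * δ ^ 2 * m)) :=
        mul_le_mul_of_nonneg_left h2 (sq_nonneg m)
      _ = 5 * 8192 ^ d * (δ ^ 2 * m ^ 4) := by ring
      _ ≤ ((200 * (d : ℝ)) ^ d) ^ 4 * (δ ^ 2 * m ^ 4) :=
        mul_le_mul_of_nonneg_right (five_mul_pow_le hd1) (by positivity)
      _ = _ := by rw [← hs]; ring
  by_contra! h
  exact absurd h3 (not_le.2 (pow_lt_pow_left₀ h (by positivity) (by norm_num)))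

lemma noiseOp_eq (ρ : ℝ) (f : (∀ i, V i) → ℝ) :
    noiseOp μ ρ f = ∑ Y ∈ (∅ : Finset (Fin k))ᶜ.powerset, ρ ^ Y.card • relES μ ∅ Y f := by
  ext x
  have h := sum_pow_mul_altSum (univ : Finset (Fin k)) ρ fun P => Aop μ P f x
  rw [card_univ, Fintype.card_fin] at h
  rw [noiseOp, ← h, Finset.sum_apply, compl_empty]
  refine sum_congr rfl fun Y _ => ?_
  simp [relES]

lemma normSq_noiseOp_le (hμ : IsProb μ) (hε : 0 ≤ ε) (hP : EpsProduct μ ε) (hρ : 0 ≤ ρ)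
    (hρ1 : ρ ≤ 1) (f : (∀ i, V i) → ℝ) :
    normSq μ (noiseOp μ ρ f) ≤ ∑ Y, ρ ^ Y.card * ρ ^ Y.card * expect μ (ES μ Y f ^ 2) +
      16 ^ k * (k * ε) * expect μ (f ^ 2) := by
  have hb : ∀ Y : Finset (Fin k), |ρ ^ Y.card| ≤ 1 := fun Y => by
    rw [abs_of_nonneg (by positivity)]
    exact pow_le_one₀ hρ hρ1
  have h := le_of_abs_le (abs_expect_sum_relES_le hμ hε hP ∅ f hb hb)
  rw [← noiseOp_eq, ← sq, ← normSq_eq] at h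
  simp only [relES_empty, compl_empty, powerset_univ] at h
  linarith

lemma sum_lowSets_expect_ES_sq_le (hμ : IsProb μ) (hε : 0 ≤ ε) (hP : EpsProduct μ ε)
    (f : (∀ i, V i) → ℝ) :
    ∑ T ∈ lowSets k d, expect μ (ES μ T f ^ 2) ≤
      expect μ (f * ∑ T ∈ lowSets k d, ES μ T f) + 16 ^ k * (k * ε) * expect μ (f ^ 2) := by
  have hb : ∀ Y : Finset (Fin k), |if Y.card ≤ d then (1 : ℝ) else 0| ≤ 1 := fun Y => by
    split_ifs <;> norm_num
  have h := neg_le_of_abs_le (abs_expect_sum_relES_le hμ hε hP ∅ f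
    (a := fun _ => 1) (fun _ => by norm_num) hb)
  rw [expect_congr_sum_relES hμ] at h
  simp only [relES_empty, compl_empty, powerset_univ, one_mul, ite_mul, zero_mul, ite_smul,
    one_smul, zero_smul, ← sum_filter] at h
  rw [lowSets]
  linarith

lemma normSq_noiseOp_le_of_isGlobal (hμ : IsProb μ) (hε : 0 ≤ ε) (hP : EpsProduct μ ε)
    (hf : IsGlobal μ d δ f) (hδ : 0 ≤ δ) (hf01 : ∀ x, f x = 0 ∨ f x = 1) (hd : d ≤ k)
    (hρ : 0 ≤ ρ) (hρ1 : ρ ≤ 1) (hk : 16 ^ k * (k * ε) ≤ 1)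
    (hk' : 5 * 32768 ^ k * (16 ^ k * (k ^ 2 * ε)) ≤ 1) :
    normSq μ (noiseOp μ ρ f) ≤
      (ρ ^ d + (200 * (d : ℝ)) ^ d * Real.sqrt δ + 3 * (16 ^ k * (k * ε))) *
        expect μ (f ^ 2) := by
  have hnn : ∀ T, 0 ≤ expect μ (ES μ T f ^ 2) := fun T => normSq_nonneg hμ _
  have hm : 0 ≤ expect μ (f ^ 2) := normSq_nonneg hμ f
  have h1 := normSq_noiseOp_le hμ hε hP hρ hρ1 f
  have h2 := sum_expect_relES_sq_le hμ hε hP ∅ f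
  simp only [relES_empty, compl_empty, powerset_univ] at h2
  set η := 16 ^ k * (k * ε) with hη
  have hη0 : 0 ≤ η := by positivity
  have hρd : ρ ^ d ≤ 1 := pow_le_one₀ hρ hρ1
  have hρd0 : 0 ≤ ρ ^ d := by positivity
  have hle : ∀ Y : Finset (Fin k), ρ ^ Y.card ≤ 1 := fun Y => pow_le_one₀ hρ hρ1
  have hge : ∀ Y : Finset (Fin k), 0 ≤ ρ ^ Y.card := fun Y => by positivity
  have hmul : ∀ Y : Finset (Fin k), ρ ^ Y.card * ρ ^ Y.card ≤ ρ ^ Y.card := fun Y =>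
    mul_le_of_le_one_left (hge Y) (hle Y)
  have hηm : 0 ≤ η * expect μ (f ^ 2) := mul_nonneg hη0 hm
  rcases Nat.eq_zero_or_pos d with rfl | hd1
  · have h3 : ∑ Y, ρ ^ Y.card * ρ ^ Y.card * expect μ (ES μ Y f ^ 2) ≤
        ∑ Y, expect μ (ES μ Y f ^ 2) := sum_le_sum fun Y _ =>
      mul_le_of_le_one_left (hnn Y) ((hmul Y).trans (hle Y))
    have h4 : 0 ≤ Real.sqrt δ * expect μ (f ^ 2) := mul_nonneg (Real.sqrt_nonneg _) hm
    rw [pow_zero, pow_zero]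
    linarith
  · have h3 : ∑ Y, ρ ^ Y.card * ρ ^ Y.card * expect μ (ES μ Y f ^ 2) ≤
        ∑ T ∈ lowSets k d, expect μ (ES μ T f ^ 2) +
          ρ ^ d * ∑ Y, expect μ (ES μ Y f ^ 2) := by
      rw [lowSets, sum_filter, mul_sum, ← sum_add_distrib]
      refine sum_le_sum fun Y _ => ?_
      have h0 := mul_nonneg hρd0 (hnn Y)
      split_ifs with hY
      · linarith [mul_le_of_le_one_left (hnn Y) ((hmul Y).trans (hle Y))]
      · rw [zero_add]
        exact mul_le_mul_of_nonneg_right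
          ((hmul Y).trans (pow_le_pow_of_le_one hρ hρ1 (by omega))) (hnn Y)
    have h4 := sum_lowSets_expect_ES_sq_le (d := d) hμ hε hP f
    have h5 := expect_mul_sum_ES_le hμ hε hP hf hδ hf01 hd1 hd hk hk'
    rw [← hη] at h4
    have h6 := mul_le_mul_of_nonneg_left h2 hρd0
    have h7 := mul_le_of_le_one_left hηm hρd
    linarith

end SmallSet

theorem statement3 (k : ℕ) (hk : 1 ≤ k) :
    ∃ ε₀ C : ℝ, 0 < ε₀ ∧ 0 < C ∧
      ∀ (V : Fin k → Type) [∀ i, Fintype (V i)] [∀ i, DecidableEq (V i)]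
        (μ : (∀ i, V i) → ℝ) (ε δ ρ : ℝ) (d : ℕ) (f : (∀ i, V i) → ℝ),
        0 < ε → ε ≤ ε₀ → IsProb μ → EpsProduct μ ε → 0 < ρ → ρ < 1 → d ≤ k → 0 < δ →
        (∀ x, f x = 0 ∨ f x = 1) → IsGlobal μ d δ f →
        normSq μ (noiseOp μ ρ f) ≤
          (ρ ^ d + (200 * (d : ℝ)) ^ d * Real.sqrt δ + C * Real.sqrt ε) * normSq μ f := by
  have hk0 : (1 : ℝ) ≤ k := by exact_mod_cast hk
  have hkk : (k : ℝ) ≤ (k : ℝ) ^ 2 := by nlinarith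
  set N : ℝ := 5 * 32768 ^ k * (16 ^ k * (k : ℝ) ^ 2) with hN
  have hN0 : 0 < N := by positivity
  have h32 : (1 : ℝ) ≤ 5 * 32768 ^ k := by
    have : (1 : ℝ) ≤ 32768 ^ k := one_le_pow₀ (by norm_num)
    linarith
  have h16 : (1 : ℝ) ≤ 16 ^ k := one_le_pow₀ (by norm_num)
  refine ⟨1 / N, 3 * (16 ^ k * k), by positivity, by positivity, ?_⟩
  intro V _ _ μ ε δ ρ d f hε hε₀ hμ hP hρ hρ1 hd hδ hf01 hf
  have hk' : 5 * 32768 ^ k * (16 ^ k * ((k : ℝ) ^ 2 * ε)) ≤ 1 := by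
    rw [le_div_iff₀ hN0] at hε₀
    calc _ = ε * N := by rw [hN]; ring
      _ ≤ 1 := hε₀
  have hk1 : 16 ^ k * ((k : ℝ) ^ 2 * ε) ≤ 1 :=
    (le_mul_of_one_le_left (by positivity) h32).trans hk'
  have hk2 : 16 ^ k * ((k : ℝ) * ε) ≤ 1 := le_trans (by gcongr) hk1
  have hε1 : ε ≤ 1 :=
    (le_mul_of_one_le_left hε.le (one_le_mul_of_one_le_of_one_le h16 hk0)).trans
      (by linarith)
  have hεs : ε ≤ Real.sqrt ε := Real.le_sqrt_of_sq_le (by nlinarith)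
  refine (normSq_noiseOp_le_of_isGlobal hμ hε.le hP hf hδ.le hf01 hd hρ.le hρ1.le hk2
    hk').trans (mul_le_mul_of_nonneg_right ?_ (normSq_nonneg hμ f))
  have : 3 * (16 ^ k * ((k : ℝ) * ε)) ≤ 3 * (16 ^ k * k) * Real.sqrt ε := by
    rw [← mul_assoc (16 ^ k : ℝ), ← mul_assoc]
    exact mul_le_mul_of_nonneg_left hεs (by positivity)
  linarith

end GLL
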